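/- arXiv:1503.04519 — 2 statements merged into one kernel-verified Lean document; each statement's English description precedes it below -/
import Mathlib

section
/- Let p be a prime with p > 3.67×10^71. Then g(p) ≤ √p − 2. -/
/-- The least primitive root modulo `p`: the smallest positive integer whose
residue class has order `p - 1` in `ZMod p` (equivalently, generates `(ZMod p)ˣ`). -/
noncomputable def leastPrimitiveRoot (p : ℕ) : ℕ :=
  sInf {n : ℕ | 0 < n ∧ orderOf ((n : ZMod p)) = p - 1}

section Stepanov

open Polynomial

/-- The operator on `a` with `s ^ l * (a * E)^{(l)} = stepanovOp s w l a * E` for every `E`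
such that `E' * s = E * w`. -/
noncomputable def stepanovOp {K : Type*} [Field K] (s w : K[X]) : ℕ → K[X] →ₗ[K] K[X]
  | 0 => LinearMap.id
  | l + 1 => (LinearMap.mulRight K s ∘ₗ derivative +
      LinearMap.mulRight K (w - C (l : K) * derivative s)) ∘ₗ stepanovOp s w l

section Operator

variable {K : Type*} [Field K]

lemma stepanovOp_succ (s w : K[X]) (l : ℕ) (a : K[X]) :
    stepanovOp s w (l + 1) a = derivative (stepanovOp s w l a) * s +
      stepanovOp s w l a * (w - C (l : K) * derivative s) := by
  simp [stepanovOp]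

lemma pow_mul_iterate_derivative_eq {s w E : K[X]} (hE : derivative E * s = E * w) (a : K[X])
    (l : ℕ) : s ^ l * derivative^[l] (a * E) = stepanovOp s w l a * E := by
  induction l with
  | zero => simp [stepanovOp]
  | succ l ih =>
    have h := congrArg (fun f => derivative f * s) ih
    simp only [derivative_mul, derivative_pow] at h
    rw [Function.iterate_succ_apply', stepanovOp_succ]
    have h2 : s ^ (l + 1) * derivative (derivative^[l] (a * E)) =
        (derivative (stepanovOp s w l a) * E + stepanovOp s w l a * derivative E) * s -
        C (l : K) * derivative s * (s ^ l * derivative^[l] (a * E)) := by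
      rw [← h]
      rcases l with _ | l
      · simp; ring
      · simp only [Nat.add_sub_cancel]; ring
    rw [h2, ih]
    linear_combination stepanovOp s w l a * hE

lemma stepanovOp_mem_degreeLT {s w : K[X]} (hs : s.natDegree ≤ 4) (hw : w.natDegree ≤ 3)
    {A : ℕ} {a : K[X]} (ha : a ∈ degreeLT K A) (l : ℕ) :
    stepanovOp s w l a ∈ degreeLT K (A + 3 * l) := by
  induction l with
  | zero => simpa [stepanovOp] using ha
  | succ l ih =>
    rw [stepanovOp_succ]
    set b := stepanovOp s w l a
    rcases eq_or_ne b 0 with hb | hb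
    · simp [hb]
    rw [mem_degreeLT, ← natDegree_lt_iff_degree_lt hb] at ih
    refine Submodule.add_mem _ ?_ ?_
    · rcases eq_or_ne (derivative b) 0 with hd | hd
      · simp [hd]
      have h1 : (derivative b).natDegree < b.natDegree := by
        refine natDegree_derivative_lt ?_
        intro h0
        exact hd (derivative_of_natDegree_zero h0)
      rw [mem_degreeLT]
      refine lt_of_le_of_lt (degree_le_natDegree) ?_
      have := natDegree_mul_le (p := derivative b) (q := s)
      exact_mod_cast (by omega : (derivative b * s).natDegree < A + 3 * (l + 1))
    · rw [mem_degreeLT]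
      refine lt_of_le_of_lt (degree_le_natDegree) ?_
      have h1 := natDegree_mul_le (p := b) (q := w - C (l : K) * derivative s)
      have h2 : (w - C (l : K) * derivative s).natDegree ≤ 3 := by
        refine (natDegree_sub_le _ _).trans (max_le hw ?_)
        refine (natDegree_C_mul_le _ _).trans ?_
        have := natDegree_derivative_le s
        omega
      exact_mod_cast (by omega : (b * (w - C (l : K) * derivative s)).natDegree < A + 3 * (l + 1))

/-- Linear independence of the monomials used in the auxiliary polynomial. -/
lemma sum_mul_ne_zero {t : K} {p k D T : ℕ} (hDk : D * k + 1 = p)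
    {u₀ v : K[X]} (hu₀ : u₀.eval t ≠ 0) (hv : v.eval t ≠ 0) (a : ℕ → K[X])
    (ha : ∀ j, a j ∈ degreeLT K k)
    (h0 : ∑ j ∈ Finset.range T, a j * ((X - C t) ^ (p * (j / D)) *
      ((X - C t) * u₀) ^ (k * (j % D)) * v ^ (k * (D - 1 - j % D))) = 0) :
    ∀ j < T, a j = 0 := by
  intro j
  induction j using Nat.strong_induction_on with
  | _ j ih =>
  intro hj
  by_contra hne
  set τ : K[X] := X - C t with hτ
  have hexp : ∀ j, p * (j / D) + k * (j % D) = k * j + j / D := by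
    intro j
    have := Nat.div_add_mod j D
    subst hDk
    calc _ = k * (D * (j / D) + j % D) + j / D := by ring
      _ = _ := by rw [this]
  have hdvd : τ ^ (k * j + j / D + k) ∣ a j * (τ ^ (p * (j / D)) *
      (τ * u₀) ^ (k * (j % D)) * v ^ (k * (D - 1 - j % D))) := by
    rw [← Finset.add_sum_erase _ _ (Finset.mem_range.2 hj), add_eq_zero_iff_eq_neg] at h0
    rw [h0, dvd_neg]
    refine Finset.dvd_sum fun i hi => ?_
    rw [Finset.mem_erase, Finset.mem_range] at hi
    rcases lt_or_gt_of_ne hi.1 with hlt | hgt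
    · rw [ih i hlt hi.2]; simp
    · refine Dvd.dvd.mul_left ?_ _
      refine Dvd.dvd.mul_right ?_ _
      rw [mul_pow, ← mul_assoc, ← pow_add, hexp]
      refine Dvd.dvd.mul_right (pow_dvd_pow _ ?_) _
      have h1 : j / D ≤ i / D := Nat.div_le_div_right hgt.le
      have h2 : k * (j + 1) ≤ k * i := Nat.mul_le_mul_left _ hgt
      linarith
  have hτ0 : τ ≠ 0 := X_sub_C_ne_zero t
  have hpr : Prime τ := prime_X_sub_C t
  have h2 : τ ^ k ∣ a j * (u₀ ^ (k * (j % D)) * v ^ (k * (D - 1 - j % D))) := by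
    have : a j * (τ ^ (p * (j / D)) * (τ * u₀) ^ (k * (j % D)) * v ^ (k * (D - 1 - j % D))) =
      τ ^ (k * j + j / D) * (a j * (u₀ ^ (k * (j % D)) * v ^ (k * (D - 1 - j % D)))) := by
      rw [← hexp, pow_add, mul_pow]; ring
    rw [this, pow_add] at hdvd
    exact (mul_dvd_mul_iff_left (pow_ne_zero _ hτ0)).1 hdvd
  have h3 : τ ^ k ∣ a j := by
    refine hpr.pow_dvd_of_dvd_mul_right k ?_ h2
    intro hd
    rw [hτ, dvd_iff_isRoot, IsRoot.def, eval_mul, eval_pow, eval_pow] at hd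
    exact mul_ne_zero (pow_ne_zero _ hu₀) (pow_ne_zero _ hv) hd
  have h4 := ha j
  rw [mem_degreeLT] at h4
  refine hne (eq_zero_of_dvd_of_degree_lt h3 ?_)
  rwa [hτ, degree_pow, degree_X_sub_C, nsmul_one]

end Operator

lemma card_mul_le_natDegree {p : ℕ} [Fact p.Prime] {f : (ZMod p)[X]} (hf : f ≠ 0) {m : ℕ}
    (hm : m ≤ p) (s : Finset (ZMod p))
    (h : ∀ x ∈ s, ∀ l < m, (derivative^[l] f).eval x = 0) : s.card * m ≤ f.natDegree := by
  rcases Nat.eq_zero_or_pos m with rfl | hm0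
  · simp
  have hdvd : ∏ x ∈ s, (X - C x) ^ m ∣ f := by
    refine Finset.prod_dvd_of_coprime ?_ ?_
    · intro x _ y _ hxy
      exact (pairwise_coprime_X_sub_C Function.injective_id hxy).pow
    · intro x hx
      rw [← le_rootMultiplicity_iff hf]
      have := lt_rootMultiplicity_of_isRoot_iterate_derivative_of_mem_nonZeroDivisors
        (n := m - 1) (t := x) hf (fun l hl => h x hx l (by omega)) ?_
      · omega
      · refine mem_nonZeroDivisors_of_ne_zero ?_
        rw [Ne, CharP.cast_eq_zero_iff (ZMod p) p, (Fact.out : p.Prime).dvd_factorial]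
        omega
  have h2 := natDegree_le_of_dvd hdvd hf
  rw [natDegree_prod_of_monic _ _ fun x _ => (monic_X_sub_C x).pow m] at h2
  simpa [natDegree_pow] using h2

lemma derivative_mul_eq {p : ℕ} [Fact p.Prime] (t : ZMod p) (u v : (ZMod p)[X]) (i α β : ℕ) :
    derivative ((X - C t) ^ (p * i) * u ^ α * v ^ β) * (u * v) =
      ((X - C t) ^ (p * i) * u ^ α * v ^ β) *
        (C (α : ZMod p) * derivative u * v + C (β : ZMod p) * u * derivative v) := by
  have h1 : derivative ((X - C t) ^ (p * i)) = 0 := by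
    simp [derivative_pow]
  have h2 : ∀ (f : (ZMod p)[X]) (n : ℕ), derivative (f ^ n) * f =
      f ^ n * (C (n : ZMod p) * derivative f) := by
    intro f n
    rcases n with _ | n
    · simp
    · rw [derivative_pow_succ]; push_cast; ring
  rw [derivative_mul, derivative_mul, h1]
  linear_combination (X - C t) ^ (p * i) * v ^ β * v * h2 u α +
    (X - C t) ^ (p * i) * u ^ α * u * h2 v β

/-- Stepanov's construction: a bound for the number of points at which `u / v` is a nonzero
`D`-th power. -/
lemma stepanov_bound {p : ℕ} [Fact p.Prime] {D k m I : ℕ} (hDk : D * k + 1 = p) (hm : m ≤ p)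
    (hI : m * (k + I + 3 * m) < I * D * k)
    (t : ZMod p) (u₀ v : (ZMod p)[X]) (hu₀ : u₀.eval t ≠ 0) (hv : v.eval t ≠ 0)
    (hdu : u₀.natDegree ≤ 1) (hdv : v.natDegree ≤ 2) (s : Finset (ZMod p))
    (hs : ∀ x ∈ s, ((X - C t) * u₀).eval x ≠ 0 ∧ v.eval x ≠ 0 ∧
      ((X - C t) * u₀).eval x ^ k = v.eval x ^ k) :
    s.card * m ≤ p * (I + 1) := by
  have hD : 0 < D := by
    rcases Nat.eq_zero_or_pos D with rfl | h
    · simp at hI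
    · exact h
  set τ : (ZMod p)[X] := X - C t with hτ
  set u := τ * u₀ with hu
  have hτd : τ.natDegree = 1 := natDegree_X_sub_C t
  have hud : u.natDegree ≤ 2 := by
    have h1 : u.natDegree ≤ τ.natDegree + u₀.natDegree := natDegree_mul_le
    omega
  set w : ℕ → (ZMod p)[X] := fun j => C ((k * (j % D) : ℕ) : ZMod p) * derivative u * v +
    C ((k * (D - 1 - j % D) : ℕ) : ZMod p) * u * derivative v with hw
  set E : ℕ → (ZMod p)[X] := fun j => τ ^ (p * (j / D)) * u ^ (k * (j % D)) *
    v ^ (k * (D - 1 - j % D)) with hE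
  have hEw : ∀ j, derivative (E j) * (u * v) = E j * w j := fun j => derivative_mul_eq t u v _ _ _
  have hsd : (u * v).natDegree ≤ 4 := by
    have := natDegree_mul_le (p := u) (q := v)
    omega
  have hwd : ∀ j, (w j).natDegree ≤ 3 := by
    intro j
    have h1 := natDegree_derivative_le u
    have h2 := natDegree_derivative_le v
    refine (natDegree_add_le _ _).trans (max_le ?_ ?_)
    · rw [mul_assoc]
      refine (natDegree_C_mul_le _ _).trans (natDegree_mul_le.trans (by omega))
    · rw [mul_assoc]
      refine (natDegree_C_mul_le _ _).trans (natDegree_mul_le.trans (by omega))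
  set T := I * D with hT
  set N := k + I + 3 * m with hN
  -- the linear conditions on the coefficients
  let L : (Fin T → degreeLT (ZMod p) k) →ₗ[ZMod p] (Fin m × Fin N → ZMod p) :=
    LinearMap.pi fun li => ∑ j : Fin T, lcoeff (ZMod p) (li.2 : ℕ) ∘ₗ
      LinearMap.mulRight (ZMod p) (τ ^ ((j : ℕ) / D)) ∘ₗ stepanovOp (u * v) (w j) (li.1 : ℕ) ∘ₗ
      (degreeLT (ZMod p) k).subtype ∘ₗ LinearMap.proj j
  have hker : LinearMap.ker L ≠ ⊥ := by
    apply LinearMap.ker_ne_bot_of_finrank_lt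
    have h1 : Module.finrank (ZMod p) (Fin T → degreeLT (ZMod p) k) = T * k := by
      rw [Module.finrank_pi_fintype]
      simp [LinearEquiv.finrank_eq (degreeLTEquiv (ZMod p) k)]
    have h2 : Module.finrank (ZMod p) (Fin m × Fin N → ZMod p) = m * N := by
      simp
    rw [h1, h2]
    exact hI
  obtain ⟨c, hcL, hc0⟩ := Submodule.exists_mem_ne_zero_of_ne_bot hker
  set a : ℕ → (ZMod p)[X] := fun j => if hj : j < T then (c ⟨j, hj⟩ : (ZMod p)[X]) else 0 with ha
  have hadeg : ∀ j, a j ∈ degreeLT (ZMod p) k := by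
    intro j
    simp only [ha]
    split_ifs
    · exact (c _).2
    · exact Submodule.zero_mem _
  have hac : ∀ j : Fin T, a j = c j := fun j => by simp [ha]
  have hcond : ∀ l < m, ∑ j ∈ Finset.range T,
      stepanovOp (u * v) (w j) l (a j) * τ ^ (j / D) = 0 := by
    intro l hl
    set q := ∑ j ∈ Finset.range T, stepanovOp (u * v) (w j) l (a j) * τ ^ (j / D) with hq
    have hqdeg : q ∈ degreeLT (ZMod p) N := by
      refine Submodule.sum_mem _ fun j hj => ?_
      have h1 := stepanovOp_mem_degreeLT hsd (hwd j) (hadeg j) l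
      rcases eq_or_ne (stepanovOp (u * v) (w j) l (a j)) 0 with h0 | h0
      · simp [h0]
      rw [mem_degreeLT, ← natDegree_lt_iff_degree_lt h0] at h1
      rw [mem_degreeLT]
      refine lt_of_le_of_lt degree_le_natDegree ?_
      have h2 := natDegree_mul_le (p := stepanovOp (u * v) (w j) l (a j)) (q := τ ^ (j / D))
      have h3 := natDegree_pow_le (p := τ) (n := j / D)
      have h4 : j / D < I := by
        rw [Nat.div_lt_iff_lt_mul hD]; exact Finset.mem_range.1 hj
      rw [hτd] at h3
      exact_mod_cast (by omega : (stepanovOp (u * v) (w j) l (a j) * τ ^ (j / D)).natDegree < N)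
    ext i
    rw [coeff_zero]
    by_cases hi : i < N
    · have := congrFun (LinearMap.mem_ker.1 hcL) (⟨l, hl⟩, ⟨i, hi⟩)
      simp only [L, LinearMap.pi_apply, LinearMap.sum_apply, LinearMap.comp_apply,
        LinearMap.proj_apply, Submodule.subtype_apply, lcoeff_apply, LinearMap.mulRight_apply,
        Pi.zero_apply] at this
      rw [hq, finsetSum_coeff, Finset.sum_range]
      simpa only [hac] using this
    · rw [mem_degreeLT] at hqdeg
      exact coeff_eq_zero_of_degree_lt (lt_of_lt_of_le hqdeg (by exact_mod_cast not_lt.1 hi))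
  set Ψ := ∑ j ∈ Finset.range T, a j * E j with hΨ
  have hΨ0 : Ψ ≠ 0 := by
    intro h0
    have h1 := sum_mul_ne_zero hDk hu₀ hv a hadeg h0
    refine hc0 (funext fun j => Subtype.ext ?_)
    rw [← hac]
    exact h1 j j.2
  have hΨd : Ψ.natDegree ≤ p * (I + 1) := by
    refine natDegree_sum_le_of_forall_le _ _ fun j hj => ?_
    have h4 : j / D + 1 ≤ I := by
      rw [Nat.succ_le_iff, Nat.div_lt_iff_lt_mul hD]; exact Finset.mem_range.1 hj
    have h5 : j % D < D := Nat.mod_lt _ hD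
    have e0 : (a j).natDegree ≤ k := by
      refine natDegree_le_of_degree_le ?_
      exact (mem_degreeLT.1 (hadeg j)).le
    have e1 : (τ ^ (p * (j / D))).natDegree ≤ p * (j / D) := by
      refine natDegree_pow_le.trans ?_
      rw [hτd, mul_one]
    have e2 : (u ^ (k * (j % D))).natDegree ≤ k * (j % D) * 2 :=
      natDegree_pow_le.trans (Nat.mul_le_mul_left _ hud)
    have e3 : (v ^ (k * (D - 1 - j % D))).natDegree ≤ k * (D - 1 - j % D) * 2 :=
      natDegree_pow_le.trans (Nat.mul_le_mul_left _ hdv)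
    have e4 : k * (j % D) * 2 + k * (D - 1 - j % D) * 2 + 2 * k = 2 * (D * k) := by
      have : j % D + (D - 1 - j % D) + 1 = D := by omega
      calc _ = 2 * ((j % D + (D - 1 - j % D) + 1) * k) := by ring
        _ = _ := by rw [this]
    have e5 : p * (j / D + 1) ≤ p * I := Nat.mul_le_mul_left _ h4
    have e6 := natDegree_mul_le (p := a j) (q := E j)
    have e7 := natDegree_mul_le (p := τ ^ (p * (j / D)) * u ^ (k * (j % D)))
      (q := v ^ (k * (D - 1 - j % D)))
    have e8 := natDegree_mul_le (p := τ ^ (p * (j / D))) (q := u ^ (k * (j % D)))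
    have e9 : (E j).natDegree = (τ ^ (p * (j / D)) * u ^ (k * (j % D)) *
      v ^ (k * (D - 1 - j % D))).natDegree := rfl
    nlinarith
  refine (card_mul_le_natDegree hΨ0 hm s fun x hx l hl => ?_).trans hΨd
  obtain ⟨hux, hvx, huv⟩ := hs x hx
  have h1 : (u * v) ^ l * derivative^[l] Ψ =
      ∑ j ∈ Finset.range T, stepanovOp (u * v) (w j) l (a j) * E j := by
    rw [hΨ, iterate_derivative_sum, Finset.mul_sum]
    exact Finset.sum_congr rfl fun j _ => pow_mul_iterate_derivative_eq (hEw j) (a j) l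
  have h2 : ∀ j, (E j).eval x = (τ ^ (j / D)).eval x * v.eval x ^ (k * (D - 1)) := by
    intro j
    have h5 : j % D < D := Nat.mod_lt _ hD
    simp only [hE, eval_mul, eval_pow]
    rw [pow_mul (eval x τ) p, ZMod.pow_card, pow_mul (eval x u), huv, ← pow_mul, mul_assoc,
      ← pow_add, ← mul_add]
    congr 3
    omega
  have h3 := congrArg (eval x) h1
  rw [eval_mul, eval_pow, eval_mul, eval_finsetSum] at h3
  have h4 : ∑ j ∈ Finset.range T, (stepanovOp (u * v) (w j) l (a j) * E j).eval x =
      (∑ j ∈ Finset.range T, stepanovOp (u * v) (w j) l (a j) * τ ^ (j / D)).eval x *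
        v.eval x ^ (k * (D - 1)) := by
    rw [eval_finsetSum, Finset.sum_mul]
    refine Finset.sum_congr rfl fun j _ => ?_
    rw [eval_mul, h2, eval_mul]; ring
  rw [h4, hcond l hl, eval_zero, zero_mul] at h3
  exact (mul_eq_zero.1 h3).resolve_left (pow_ne_zero _ (mul_ne_zero hux hvx))

lemma stepanov_bound_sqrt {p : ℕ} [Fact p.Prime] (hp : 10000 ≤ p) {D k : ℕ} (hD : 2 ≤ D)
    (hDk : D * k + 1 = p)
    (t : ZMod p) (u₀ v : (ZMod p)[X]) (hu₀ : u₀.eval t ≠ 0) (hv : v.eval t ≠ 0)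
    (hdu : u₀.natDegree ≤ 1) (hdv : v.natDegree ≤ 2) (s : Finset (ZMod p))
    (hs : ∀ x ∈ s, ((X - C t) * u₀).eval x ≠ 0 ∧ v.eval x ≠ 0 ∧
      ((X - C t) * u₀).eval x ^ k = v.eval x ^ k) :
    s.card * (p.sqrt * D) ≤ p * (p.sqrt + 6 * D) := by
  set m := p.sqrt with hm
  have h1 : m * m ≤ p := Nat.sqrt_le p
  have h2 : 100 ≤ m := by rw [hm, Nat.le_sqrt]; omega
  have h3 : m / D * D ≤ m := Nat.div_mul_le_self m D
  have h4 : m < D * (m / D + 1) := Nat.lt_mul_div_succ m (by omega)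
  have h5 : 2 * (m / D) ≤ m := by nlinarith
  have hk0 : 0 < k := by
    rcases Nat.eq_zero_or_pos k with rfl | h
    · omega
    · exact h
  have key := stepanov_bound (m := m) (I := m / D + 5) hDk (by nlinarith) ?_ t u₀ v hu₀ hv hdu hdv s hs
  · calc s.card * (m * D) = (s.card * m) * D := by ring
      _ ≤ p * (m / D + 5 + 1) * D := Nat.mul_le_mul_right _ key
      _ = p * (m / D * D + 6 * D) := by ring
      _ ≤ _ := by gcongr
  · have h6 : m * k < D * (m / D + 1) * k := Nat.mul_lt_mul_of_pos_right h4 hk0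
    have h7 : m * (m / D + 5 + 3 * m) ≤ 4 * (D * k) := by nlinarith
    nlinarith

lemma card_pow_eq_le_of_ne {p : ℕ} [Fact p.Prime] (hp : 10000 ≤ p) {D k : ℕ} (hD : 2 ≤ D)
    (hDk : D * k + 1 = p) {y₁ y₂ y₃ y₄ : ZMod p} (h₂ : y₁ ≠ y₂) (h₃ : y₁ ≠ y₃) (h₄ : y₁ ≠ y₄)
    (s : Finset (ZMod p))
    (hs : ∀ x ∈ s, x + y₁ ≠ 0 ∧ x + y₂ ≠ 0 ∧ x + y₃ ≠ 0 ∧ x + y₄ ≠ 0 ∧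
      ((x + y₁) * (x + y₂)) ^ k = ((x + y₃) * (x + y₄)) ^ k) :
    s.card * (p.sqrt * D) ≤ p * (p.sqrt + 6 * D) := by
  refine stepanov_bound_sqrt hp hD hDk (-y₁) (X + C y₂) ((X + C y₃) * (X + C y₄)) ?_ ?_ ?_ ?_ s ?_
  · simp only [eval_add, eval_X, eval_C]
    intro h; exact h₂ (by linear_combination -h)
  · simp only [eval_mul, eval_add, eval_X, eval_C]
    refine mul_ne_zero (fun h => h₃ ?_) (fun h => h₄ ?_) <;> linear_combination -h
  · rw [natDegree_X_add_C]
  · refine natDegree_mul_le.trans ?_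
    rw [natDegree_X_add_C, natDegree_X_add_C]
  · intro x hx
    obtain ⟨a1, a2, a3, a4, a5⟩ := hs x hx
    simp only [eval_mul, eval_sub, eval_add, eval_X, eval_C, sub_neg_eq_add]
    exact ⟨mul_ne_zero a1 a2, mul_ne_zero a3 a4, a5⟩

/-- The condition defining the multiplicative energy of `x + Y` modulo `D`-th powers,
where `k = (p - 1) / D`. -/
def EnergyRel {p : ℕ} (k : ℕ) (x : ZMod p) (y : ZMod p × ZMod p × ZMod p × ZMod p) : Prop :=
  ((x + y.1) * (x + y.2.1)) ^ k = ((x + y.2.2.1) * (x + y.2.2.2)) ^ k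

instance {p : ℕ} (k : ℕ) (x : ZMod p) (y : ZMod p × ZMod p × ZMod p × ZMod p) :
    Decidable (EnergyRel k x y) := by
  unfold EnergyRel; infer_instance

/-- The points `x` such that `x + Y` does not contain zero. -/
def goodPoints {p : ℕ} [NeZero p] (Y : Finset (ZMod p)) : Finset (ZMod p) :=
  Finset.univ.filter fun x => ∀ y ∈ Y, x + y ≠ 0

lemma sum_energy_le {p : ℕ} [Fact p.Prime] (hp : 10000 ≤ p) {D k : ℕ} (hD : 2 ≤ D)
    (hDk : D * k + 1 = p) (Y : Finset (ZMod p)) :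
    ((∑ x ∈ goodPoints Y, ((Y ×ˢ Y ×ˢ Y ×ˢ Y).filter (EnergyRel k x)).card : ℕ) : ℝ) ≤
      3 * (Y.card : ℝ) ^ 2 * p + (Y.card : ℝ) ^ 4 * (p / D + 6 * p / p.sqrt) := by
  classical
  have hm : (0 : ℝ) < p.sqrt := by
    have : 0 < p.sqrt := Nat.sqrt_pos.2 (by omega)
    exact_mod_cast this
  have hD0 : (0 : ℝ) < D := by exact_mod_cast (by omega : 0 < D)
  set deg : Finset (ZMod p × ZMod p × ZMod p × ZMod p) :=
    (Y ×ˢ Y).image (fun z => (z.1, z.1, z.2, z.2)) ∪ ((Y ×ˢ Y).image (fun z => (z.1, z.2, z.1, z.2)) ∪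
      (Y ×ˢ Y).image (fun z => (z.1, z.2, z.2, z.1))) with hdeg
  have hdegc : deg.card ≤ 3 * Y.card ^ 2 := by
    have h1 : ∀ f : ZMod p × ZMod p → ZMod p × ZMod p × ZMod p × ZMod p,
        ((Y ×ˢ Y).image f).card ≤ Y.card ^ 2 := fun f =>
      Finset.card_image_le.trans (by rw [Finset.card_product, sq])
    refine (Finset.card_union_le _ _).trans ?_
    have h2 := Finset.card_union_le ((Y ×ˢ Y).image (fun z => (z.1, z.2, z.1, z.2)))
      ((Y ×ˢ Y).image (fun z => (z.1, z.2, z.2, z.1)))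
    have a1 := h1 (fun z => (z.1, z.1, z.2, z.2))
    have a2 := h1 (fun z => (z.1, z.2, z.1, z.2))
    have a3 := h1 (fun z => (z.1, z.2, z.2, z.1))
    omega
  have hswap : ∑ x ∈ goodPoints Y, ((Y ×ˢ Y ×ˢ Y ×ˢ Y).filter (EnergyRel k x)).card =
      ∑ y ∈ Y ×ˢ Y ×ˢ Y ×ˢ Y, ((goodPoints Y).filter (fun x => EnergyRel k x y)).card := by
    exact Finset.sum_card_bipartiteAbove_eq_sum_card_bipartiteBelow (r := EnergyRel k)
  have hpoint : ∀ y ∈ Y ×ˢ Y ×ˢ Y ×ˢ Y,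
      (((goodPoints Y).filter (fun x => EnergyRel k x y)).card : ℝ) ≤
        (if y ∈ deg then (p : ℝ) else 0) + (p / D + 6 * p / p.sqrt) := by
    rintro ⟨y₁, y₂, y₃, y₄⟩ hy
    simp only [Finset.mem_product] at hy
    obtain ⟨m1, m2, m3, m4⟩ := hy
    set s := (goodPoints Y).filter (fun x => EnergyRel k x (y₁, y₂, y₃, y₄)) with hs
    have hs' : ∀ x ∈ s, x + y₁ ≠ 0 ∧ x + y₂ ≠ 0 ∧ x + y₃ ≠ 0 ∧ x + y₄ ≠ 0 ∧
        ((x + y₁) * (x + y₂)) ^ k = ((x + y₃) * (x + y₄)) ^ k := by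
      intro x hx
      simp only [hs, goodPoints, Finset.mem_filter, Finset.mem_univ, true_and] at hx
      exact ⟨hx.1 _ m1, hx.1 _ m2, hx.1 _ m3, hx.1 _ m4, hx.2⟩
    have hpos : (0 : ℝ) ≤ p / D + 6 * p / p.sqrt := by positivity
    split_ifs with hyd
    · have h1 : s.card ≤ p := by
        simpa [ZMod.card] using Finset.card_le_univ s
      have h2 : (s.card : ℝ) ≤ p := by exact_mod_cast h1
      linarith
    · have hmain : s.card * (p.sqrt * D) ≤ p * (p.sqrt + 6 * D) := by
        by_cases c1 : y₁ ≠ y₂ ∧ y₁ ≠ y₃ ∧ y₁ ≠ y₄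
        · exact card_pow_eq_le_of_ne hp hD hDk c1.1 c1.2.1 c1.2.2 s hs'
        by_cases c2 : y₂ ≠ y₁ ∧ y₂ ≠ y₃ ∧ y₂ ≠ y₄
        · refine card_pow_eq_le_of_ne hp hD hDk c2.1 c2.2.1 c2.2.2 s fun x hx => ?_
          obtain ⟨a1, a2, a3, a4, a5⟩ := hs' x hx
          exact ⟨a2, a1, a3, a4, by rw [mul_comm (x + y₂), a5]⟩
        by_cases c3 : y₃ ≠ y₄ ∧ y₃ ≠ y₁ ∧ y₃ ≠ y₂
        · refine card_pow_eq_le_of_ne hp hD hDk c3.1 c3.2.1 c3.2.2 s fun x hx => ?_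
          obtain ⟨a1, a2, a3, a4, a5⟩ := hs' x hx
          exact ⟨a3, a4, a1, a2, a5.symm⟩
        by_cases c4 : y₄ ≠ y₃ ∧ y₄ ≠ y₁ ∧ y₄ ≠ y₂
        · refine card_pow_eq_le_of_ne hp hD hDk c4.1 c4.2.1 c4.2.2 s fun x hx => ?_
          obtain ⟨a1, a2, a3, a4, a5⟩ := hs' x hx
          exact ⟨a4, a3, a1, a2, by rw [mul_comm (x + y₄), a5]⟩
        exfalso
        apply hyd
        simp only [hdeg, Finset.mem_union, Finset.mem_image, Finset.mem_product, Prod.exists,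
          Prod.mk.injEq]
        have : (y₁ = y₂ ∧ y₃ = y₄) ∨ (y₁ = y₃ ∧ y₂ = y₄) ∨ (y₁ = y₄ ∧ y₂ = y₃) := by
          grind
        rcases this with ⟨rfl, rfl⟩ | ⟨rfl, rfl⟩ | ⟨rfl, rfl⟩
        · exact Or.inl ⟨_, _, ⟨m1, m3⟩, rfl, rfl, rfl, rfl⟩
        · exact Or.inr (Or.inl ⟨_, _, ⟨m1, m2⟩, rfl, rfl, rfl, rfl⟩)
        · exact Or.inr (Or.inr ⟨_, _, ⟨m1, m2⟩, rfl, rfl, rfl, rfl⟩)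
      have h2 : (s.card : ℝ) * (p.sqrt * D) ≤ p * (p.sqrt + 6 * D) := by exact_mod_cast hmain
      rw [zero_add, div_add_div _ _ hD0.ne' hm.ne', le_div_iff₀ (by positivity)]
      linarith
  rw [hswap]
  push_cast
  refine (Finset.sum_le_sum hpoint).trans ?_
  rw [Finset.sum_add_distrib, Finset.sum_const, ← Finset.sum_filter, Finset.sum_const, nsmul_eq_mul,
    nsmul_eq_mul]
  have h1 : ((Y ×ˢ Y ×ˢ Y ×ˢ Y).filter (· ∈ deg)).card ≤ 3 * Y.card ^ 2 := by
    refine le_trans (Finset.card_le_card fun y hy => ?_) hdegc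
    exact (Finset.mem_filter.1 hy).2
  have h2 : (((Y ×ˢ Y ×ˢ Y ×ˢ Y).filter (· ∈ deg)).card : ℝ) ≤ 3 * (Y.card : ℝ) ^ 2 := by
    exact_mod_cast h1
  have h3 : ((Y ×ˢ Y ×ˢ Y ×ˢ Y).card : ℝ) = (Y.card : ℝ) ^ 4 := by
    simp only [Finset.card_product]; push_cast; ring
  rw [h3]
  gcongr

end Stepanov

section Sieve

open Finset

section Fourier

variable {α β : Type*} {D : ℕ} [NeZero D]

/-- Parseval's identity for an exponential sum over `ZMod D`. -/
lemma sum_norm_sq_eq_card (S : Finset α) (h : α → ZMod D) :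
    ∑ j : ZMod D, ‖∑ s ∈ S, ZMod.stdAddChar (j * h s)‖ ^ 2 =
      D * ((S ×ˢ S).filter fun z => h z.1 = h z.2).card := by
  have key : ∑ j : ZMod D, ((∑ s ∈ S, ZMod.stdAddChar (j * h s)) *
      (starRingEnd ℂ) (∑ s ∈ S, ZMod.stdAddChar (j * h s))) =
      (D * ((S ×ˢ S).filter fun z => h z.1 = h z.2).card : ℂ) := by
    have h1 : ∀ j : ZMod D, ((∑ s ∈ S, ZMod.stdAddChar (j * h s)) *
      (starRingEnd ℂ) (∑ s ∈ S, ZMod.stdAddChar (j * h s))) =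
        ∑ z ∈ S ×ˢ S, (ZMod.stdAddChar (j * (h z.1 - h z.2)) : ℂ) := by
      intro j
      rw [map_sum, sum_mul_sum, sum_product]
      refine sum_congr rfl fun s _ => sum_congr rfl fun s' _ => ?_
      rw [← AddChar.map_neg_eq_conj, ← AddChar.map_add_eq_mul]
      congr 1; ring
    rw [sum_congr rfl fun j _ => h1 j, sum_comm]
    have h2 : ∀ z : α × α, ∑ j : ZMod D, (ZMod.stdAddChar (j * (h z.1 - h z.2)) : ℂ) =
        if h z.1 = h z.2 then (D : ℂ) else 0 := by
      intro z
      rw [AddChar.sum_mulShift _ (ZMod.isPrimitive_stdAddChar D), ZMod.card]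
      simp [sub_eq_zero]
    rw [sum_congr rfl fun z _ => h2 z, ← sum_filter, sum_const, nsmul_eq_mul]
    ring
  have : ((∑ j : ZMod D, ‖∑ s ∈ S, ZMod.stdAddChar (j * h s)‖ ^ 2 : ℝ) : ℂ) =
      ((D * ((S ×ˢ S).filter fun z => h z.1 = h z.2).card : ℝ) : ℂ) := by
    push_cast
    rw [← key]
    exact sum_congr rfl fun j _ => by rw [Complex.mul_conj, Complex.normSq_eq_norm_sq]; push_cast; rfl
  exact_mod_cast this

/-- The additive energy of a family of residue classes. -/
def classEnergy (Y : Finset β) (h : β → ZMod D) : ℕ :=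
  ((Y ×ˢ Y ×ˢ Y ×ˢ Y).filter fun y => h y.1 + h y.2.1 = h y.2.2.1 + h y.2.2.2).card

lemma sum_norm_pow_four_eq (Y : Finset β) (h : β → ZMod D) :
    ∑ j : ZMod D, ‖∑ y ∈ Y, ZMod.stdAddChar (j * h y)‖ ^ 4 = D * classEnergy Y h := by
  have h1 := sum_norm_sq_eq_card (Y ×ˢ Y) (fun z => h z.1 + h z.2)
  have h2 : ∀ j : ZMod D, ‖∑ y ∈ Y, ZMod.stdAddChar (j * h y)‖ ^ 4 =
      ‖∑ z ∈ Y ×ˢ Y, ZMod.stdAddChar (j * (h z.1 + h z.2))‖ ^ 2 := by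
    intro j
    have : ∑ z ∈ Y ×ˢ Y, (ZMod.stdAddChar (j * (h z.1 + h z.2)) : ℂ) =
        (∑ y ∈ Y, ZMod.stdAddChar (j * h y)) ^ 2 := by
      rw [sq, sum_mul_sum, sum_product]
      refine sum_congr rfl fun s _ => sum_congr rfl fun s' _ => ?_
      rw [← AddChar.map_add_eq_mul, mul_add]
    rw [this, norm_pow]; ring
  rw [sum_congr rfl fun j _ => h2 j, h1, classEnergy]
  congr 2
  refine card_bij' (fun z _ => (z.1.1, z.1.2, z.2.1, z.2.2))
    (fun y _ => ((y.1, y.2.1), (y.2.2.1, y.2.2.2))) ?_ ?_ ?_ ?_ <;>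
  simp +contextual [and_assoc]

lemma sum_norm_pow_four_ne_zero (Y : Finset β) (h : β → ZMod D) :
    ∑ j ∈ (univ.erase 0 : Finset (ZMod D)), ‖∑ y ∈ Y, ZMod.stdAddChar (j * h y)‖ ^ 4 =
      D * (classEnergy Y h - (Y.card : ℝ) ^ 4 / D) := by
  have hD : (D : ℝ) ≠ 0 := by exact_mod_cast NeZero.ne D
  have h1 := sum_norm_pow_four_eq Y h
  rw [← add_sum_erase _ _ (mem_univ (0 : ZMod D))] at h1
  simp only [zero_mul, AddChar.map_zero_eq_one, sum_const, nsmul_eq_mul, mul_one,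
    RCLike.norm_natCast] at h1
  rw [mul_sub, mul_div_cancel₀ _ hD]
  linarith

lemma card_pow_four_div_le_classEnergy (Y : Finset β) (h : β → ZMod D) :
    (Y.card : ℝ) ^ 4 / D ≤ classEnergy Y h := by
  have hD : (0 : ℝ) < D := by exact_mod_cast Nat.pos_of_ne_zero (NeZero.ne D)
  have h1 := sum_norm_pow_four_ne_zero Y h
  have h2 : 0 ≤ ∑ j ∈ (univ.erase 0 : Finset (ZMod D)),
      ‖∑ y ∈ Y, (ZMod.stdAddChar (j * h y) : ℂ)‖ ^ 4 := sum_nonneg fun _ _ => by positivity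
  rw [h1] at h2
  have := nonneg_of_mul_nonneg_right h2 hD
  linarith

/-- The number of pairs in a given class. -/
def classCount (X : Finset α) (Y : Finset β) (h : α → β → ZMod D) (c : ZMod D) : ℕ :=
  ((X ×ˢ Y).filter fun z => h z.1 z.2 = c).card

lemma sum_classCount_sub_sq (X : Finset α) (Y : Finset β) (h : α → β → ZMod D) :
    ∑ c, ((classCount X Y h c : ℝ) - X.card * Y.card / D) ^ 2 =
      (∑ j ∈ (univ.erase 0 : Finset (ZMod D)),
        ‖∑ z ∈ X ×ˢ Y, ZMod.stdAddChar (j * h z.1 z.2)‖ ^ 2) / D := by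
  have hD : (D : ℝ) ≠ 0 := by exact_mod_cast NeZero.ne D
  have h1 := sum_norm_sq_eq_card (X ×ˢ Y) (fun z => h z.1 z.2)
  rw [← add_sum_erase _ _ (mem_univ (0 : ZMod D))] at h1
  simp only [zero_mul, AddChar.map_zero_eq_one, sum_const, nsmul_eq_mul, mul_one,
    RCLike.norm_natCast, card_product] at h1
  have h2 : ∑ c, classCount X Y h c = X.card * Y.card := by
    rw [← card_product]
    exact (card_eq_sum_card_fiberwise fun z _ => mem_univ (h z.1 z.2)).symm
  have h3 : ∑ c, classCount X Y h c ^ 2 =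
      (((X ×ˢ Y) ×ˢ (X ×ˢ Y)).filter fun z => h z.1.1 z.1.2 = h z.2.1 z.2.2).card := by
    rw [card_eq_sum_card_fiberwise (t := univ) (f := fun z => h z.1.1 z.1.2) fun z _ => mem_univ _]
    refine sum_congr rfl fun c _ => ?_
    rw [classCount, sq, ← card_product]
    congr 1
    ext z
    simp only [mem_product, mem_filter]
    constructor
    · rintro ⟨⟨a, b⟩, c, d⟩; exact ⟨⟨⟨a, c⟩, b.trans d.symm⟩, b⟩
    · rintro ⟨⟨⟨a, c⟩, e⟩, b⟩; exact ⟨⟨a, b⟩, c, e.symm.trans b⟩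
  have h2' : ∑ c, (classCount X Y h c : ℝ) = X.card * Y.card := by exact_mod_cast h2
  have h3' : ∑ c, (classCount X Y h c : ℝ) ^ 2 =
    (((X ×ˢ Y) ×ˢ (X ×ˢ Y)).filter fun z => h z.1.1 z.1.2 = h z.2.1 z.2.2).card := by
    exact_mod_cast h3
  rw [← h3'] at h1
  rw [eq_div_iff hD]
  have h4 : ∀ c, ((classCount X Y h c : ℝ) - X.card * Y.card / D) ^ 2 =
      (classCount X Y h c : ℝ) ^ 2 - 2 * (X.card * Y.card / D) * classCount X Y h c +
        (X.card * Y.card / D) ^ 2 := fun c => by ring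
  simp only [h4, sum_add_distrib, sum_sub_distrib, ← mul_sum, h2', sum_const, card_univ, ZMod.card,
    nsmul_eq_mul]
  push_cast at h1
  field_simp
  linarith

/-- The discrepancy of `h` in `ℓ²` is controlled by the additive energies of its rows. -/
lemma sq_discrepancy_le (X : Finset α) (Y : Finset β) (h : α → β → ZMod D) :
    (∑ c, ((classCount X Y h c : ℝ) - X.card * Y.card / D) ^ 2) ^ 2 ≤
      (X.card : ℝ) ^ 3 * ∑ x ∈ X, ((classEnergy Y (h x) : ℝ) - (Y.card : ℝ) ^ 4 / D) := by
  have hD : (0 : ℝ) < D := by exact_mod_cast Nat.pos_of_ne_zero (NeZero.ne D)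
  rcases X.eq_empty_or_nonempty with rfl | hX
  · simp [classCount]
  set J := (univ.erase 0 : Finset (ZMod D)) with hJ
  set f : α → ZMod D → ℝ := fun x j => ‖∑ y ∈ Y, (ZMod.stdAddChar (j * h x y) : ℂ)‖ with hf
  set T : ZMod D → ℝ := fun j => ‖∑ z ∈ X ×ˢ Y, (ZMod.stdAddChar (j * h z.1 z.2) : ℂ)‖ with hT
  have hT0 : ∀ j, 0 ≤ T j := fun j => norm_nonneg _
  have hTf : ∀ j, T j ≤ ∑ x ∈ X, f x j := by
    intro j
    simp only [hT]
    rw [sum_product]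
    exact norm_sum_le _ _
  have hT4 : ∀ j, T j ^ 4 ≤ (X.card : ℝ) ^ 3 * ∑ x ∈ X, f x j ^ 4 := by
    intro j
    refine (pow_le_pow_left₀ (hT0 j) (hTf j) 4).trans ?_
    have h1 := pow_sum_div_card_le_sum_pow (s := X) (f := fun x => f x j)
      (fun x _ => norm_nonneg _) 3
    rwa [div_le_iff₀ (by positivity), mul_comm] at h1
  have hJc : (J.card : ℝ) ≤ D := by
    have : J.card ≤ (univ : Finset (ZMod D)).card := card_le_card (erase_subset _ _)
    rw [card_univ, ZMod.card] at this
    exact_mod_cast this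
  have hsum : (∑ j ∈ J, T j ^ 2) ^ 2 ≤ D * ∑ j ∈ J, T j ^ 4 := by
    have h1 := sq_sum_le_card_mul_sum_sq (s := J) (f := fun j => T j ^ 2)
    have h2 : ∀ j, (T j ^ 2) ^ 2 = T j ^ 4 := fun j => by ring
    simp only [h2] at h1
    exact h1.trans (mul_le_mul_of_nonneg_right hJc (sum_nonneg fun j _ => by positivity))
  have hsum2 : ∑ j ∈ J, T j ^ 4 ≤ (X.card : ℝ) ^ 3 * (D *
      ∑ x ∈ X, ((classEnergy Y (h x) : ℝ) - (Y.card : ℝ) ^ 4 / D)) := by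
    refine (sum_le_sum fun j _ => hT4 j).trans_eq ?_
    rw [← mul_sum, sum_comm, mul_sum (a := (D : ℝ))]
    congr 1
    exact sum_congr rfl fun x _ => sum_norm_pow_four_ne_zero Y (h x)
  rw [sum_classCount_sub_sq, div_pow, div_le_iff₀ (by positivity)]
  calc _ ≤ _ := hsum
    _ ≤ D * _ := mul_le_mul_of_nonneg_left hsum2 hD.le
    _ = _ := by ring

/-- Counting in a set of classes. -/
lemma abs_sum_classCount_sub_le (X : Finset α) (Y : Finset β) (h : α → β → ZMod D)
    (S : Finset (ZMod D)) {δ : ℝ} (hδ : 0 ≤ δ)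
    (hΔ : ∑ c, ((classCount X Y h c : ℝ) - X.card * Y.card / D) ^ 2 ≤ δ ^ 2) :
    |∑ c ∈ S, (classCount X Y h c : ℝ) - S.card * (X.card * Y.card / D)| ≤
      Real.sqrt S.card * δ := by
  have h1 : ∑ c ∈ S, (classCount X Y h c : ℝ) - S.card * (X.card * Y.card / D) =
      ∑ c ∈ S, ((classCount X Y h c : ℝ) - X.card * Y.card / D) := by
    rw [sum_sub_distrib, sum_const, nsmul_eq_mul]
  rw [h1]
  refine abs_le_of_sq_le_sq ?_ (by positivity)
  rw [mul_pow, Real.sq_sqrt (Nat.cast_nonneg _)]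
  refine sq_sum_le_card_mul_sum_sq.trans ?_
  refine mul_le_mul_of_nonneg_left (le_trans ?_ hΔ) (Nat.cast_nonneg _)
  exact sum_le_sum_of_subset_of_nonneg (subset_univ _) fun _ _ _ => by positivity

end Fourier

/-- A discrete logarithm on the nonzero residues modulo `p`, to the base `g`. -/
structure IsDiscreteLog {p : ℕ} (g : (ZMod p)ˣ) (ind : ZMod p → ℕ) : Prop where
  orderOf_eq : orderOf g = p - 1
  pow_eq : ∀ z : ZMod p, z ≠ 0 → ((g ^ ind z : (ZMod p)ˣ) : ZMod p) = z

lemma exists_isDiscreteLog (p : ℕ) [Fact p.Prime] :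
    ∃ (g : (ZMod p)ˣ) (ind : ZMod p → ℕ), IsDiscreteLog g ind := by
  obtain ⟨g, hg⟩ := IsCyclic.exists_generator (α := (ZMod p)ˣ)
  have h : ∀ z : ZMod p, ∃ i : ℕ, z ≠ 0 → ((g ^ i : (ZMod p)ˣ) : ZMod p) = z := by
    intro z
    by_cases hz : z = 0
    · exact ⟨0, fun h => (h hz).elim⟩
    · have h1 := hg (Units.mk0 z hz)
      rw [← mem_powers_iff_mem_zpowers] at h1
      obtain ⟨i, hi⟩ := h1
      refine ⟨i, fun _ => ?_⟩
      have h2 : g ^ i = Units.mk0 z hz := hi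
      rw [h2]; rfl
  choose ind hind using h
  refine ⟨g, ind, ?_, hind⟩
  rw [orderOf_eq_card_of_forall_mem_zpowers hg, Nat.card_eq_fintype_card, ZMod.card_units]

namespace IsDiscreteLog

variable {p : ℕ} [Fact p.Prime] {g : (ZMod p)ˣ} {ind : ZMod p → ℕ}

lemma pow_eq_pow_iff (hg : IsDiscreteLog g ind) {D k : ℕ} (hDk : D * k + 1 = p) {z w : ZMod p}
    (hz : z ≠ 0) (hw : w ≠ 0) : z ^ k = w ^ k ↔ (ind z : ZMod D) = ind w := by
  have hk : k ≠ 0 := by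
    rintro rfl
    exact (Fact.out : p.Prime).one_lt.ne' (by omega)
  conv_lhs => rw [← hg.pow_eq z hz, ← hg.pow_eq w hw]
  rw [← Units.val_pow_eq_pow_val, ← Units.val_pow_eq_pow_val, Units.val_inj, ← pow_mul, ← pow_mul,
    _root_.pow_eq_pow_iff_modEq, hg.orderOf_eq, ZMod.natCast_eq_natCast_iff,
    show p - 1 = D * k by omega]
  exact Nat.ModEq.mul_right_cancel_iff' hk

lemma cast_mul (hg : IsDiscreteLog g ind) {D k : ℕ} (hDk : D * k + 1 = p) {z w : ZMod p}
    (hz : z ≠ 0) (hw : w ≠ 0) : (ind (z * w) : ZMod D) = ind z + ind w := by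
  have h : g ^ ind (z * w) = g ^ (ind z + ind w) := by
    rw [← Units.val_inj, hg.pow_eq _ (mul_ne_zero hz hw), pow_add, Units.val_mul, hg.pow_eq z hz,
      hg.pow_eq w hw]
  rw [_root_.pow_eq_pow_iff_modEq, hg.orderOf_eq, show p - 1 = D * k by omega] at h
  exact_mod_cast (ZMod.natCast_eq_natCast_iff _ _ _).2 (h.of_mul_right k)

lemma classEnergy_eq (hg : IsDiscreteLog g ind) {D k : ℕ} (hDk : D * k + 1 = p)
    {Y : Finset (ZMod p)} {t : ZMod p} (ht : t ∈ goodPoints Y) :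
    classEnergy Y (fun y => (ind (t + y) : ZMod D)) =
      ((Y ×ˢ Y ×ˢ Y ×ˢ Y).filter (EnergyRel k t)).card := by
  have h0 : ∀ y ∈ Y, t + y ≠ 0 := (mem_filter.1 ht).2
  rw [classEnergy]
  congr 1
  refine filter_congr fun y hy => ?_
  simp only [mem_product] at hy
  obtain ⟨h1, h2, h3, h4⟩ := hy
  rw [EnergyRel, hg.pow_eq_pow_iff hDk (mul_ne_zero (h0 _ h1) (h0 _ h2))
    (mul_ne_zero (h0 _ h3) (h0 _ h4)), hg.cast_mul hDk (h0 _ h1) (h0 _ h2),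
    hg.cast_mul hDk (h0 _ h3) (h0 _ h4)]

/-- Equidistribution of the discrete logarithms of the values `u x + v x * y`. -/
lemma sq_discrepancy_le (hg : IsDiscreteLog g ind) (hp : 10000 ≤ p) {D k : ℕ} [NeZero D]
    (hD : 2 ≤ D) (hDk : D * k + 1 = p) {α : Type*} (X : Finset α) (Y : Finset (ZMod p))
    (u v : α → ZMod p) (hv : ∀ x ∈ X, v x ≠ 0) (huv : ∀ x ∈ X, ∀ y ∈ Y, u x + v x * y ≠ 0)
    (hinj : Set.InjOn (fun x => u x / v x) X) :
    (∑ c : ZMod D, ((classCount X Y (fun x y => (ind (u x + v x * y) : ZMod D)) c : ℝ) -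
        X.card * Y.card / D) ^ 2) ^ 2 ≤
      (X.card : ℝ) ^ 3 * (3 * (Y.card : ℝ) ^ 2 * p + 6 * (Y.card : ℝ) ^ 4 * (p / p.sqrt) +
        (Y.card : ℝ) ^ 5) := by
  refine (_root_.sq_discrepancy_le X Y _).trans ?_
  refine mul_le_mul_of_nonneg_left ?_ (by positivity)
  have hgood : ∀ x ∈ X, u x / v x ∈ goodPoints Y := by
    intro x hx
    refine mem_filter.2 ⟨mem_univ _, fun y hy h => huv x hx y hy ?_⟩
    have : u x + v x * y = v x * (u x / v x + y) := by
      rw [mul_add, mul_div_cancel₀ _ (hv x hx)]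
    rw [this, h, mul_zero]
  set F : ZMod p → ℝ := fun t => (((Y ×ˢ Y ×ˢ Y ×ˢ Y).filter (EnergyRel k t)).card : ℝ) -
    (Y.card : ℝ) ^ 4 / D with hF
  have h1 : ∀ x ∈ X, (classEnergy Y (fun y => (ind (u x + v x * y) : ZMod D)) : ℝ) -
      (Y.card : ℝ) ^ 4 / D = F (u x / v x) := by
    intro x hx
    simp only [hF]
    rw [← hg.classEnergy_eq hDk (hgood x hx), classEnergy, classEnergy]
    congr 3
    refine filter_congr fun y hy => ?_
    simp only [mem_product] at hy
    have h2 : ∀ y ∈ Y, (ind (u x + v x * y) : ZMod D) = ind (v x) + ind (u x / v x + y) := by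
      intro y hy
      rw [← hg.cast_mul hDk (hv x hx) ((mem_filter.1 (hgood x hx)).2 y hy), mul_add,
        mul_div_cancel₀ _ (hv x hx)]
    obtain ⟨a, b, c, d⟩ := hy
    rw [h2 _ a, h2 _ b, h2 _ c, h2 _ d]
    constructor <;> intro h <;> linear_combination h
  rw [sum_congr rfl h1, ← sum_image (f := F) hinj]
  have h3 : ∑ t ∈ X.image (fun x => u x / v x), F t ≤ ∑ t ∈ goodPoints Y, F t := by
    refine sum_le_sum_of_subset_of_nonneg (image_subset_iff.2 hgood) fun t ht _ => ?_
    simp only [hF]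
    rw [← hg.classEnergy_eq hDk ht]
    exact sub_nonneg.2 (card_pow_four_div_le_classEnergy _ _)
  refine h3.trans ?_
  have h4 := sum_energy_le hp hD hDk Y
  have h5 : (p : ℝ) - Y.card ≤ (goodPoints Y).card := by
    have : p ≤ (goodPoints Y).card + Y.card := by
      have h6 : (univ : Finset (ZMod p)) ⊆ goodPoints Y ∪ Y.image (fun y => -y) := by
        intro t _
        by_cases ht : t ∈ goodPoints Y
        · exact mem_union_left _ ht
        · refine mem_union_right _ ?_
          simp only [goodPoints, mem_filter, mem_univ, true_and, not_forall, not_not] at ht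
          obtain ⟨y, hy, h⟩ := ht
          exact mem_image.2 ⟨y, hy, (eq_neg_of_add_eq_zero_left h).symm⟩
      have h7 := (card_le_card h6).trans (card_union_le _ _)
      rw [card_univ, ZMod.card] at h7
      exact h7.trans (Nat.add_le_add_left card_image_le _)
    rw [sub_le_iff_le_add]
    exact_mod_cast this
  have hD1 : (1 : ℝ) ≤ D := by exact_mod_cast (by omega : 1 ≤ D)
  have hD0 : (0 : ℝ) < D := by linarith
  simp only [hF, sum_sub_distrib, sum_const, nsmul_eq_mul]
  push_cast at h4
  have h8 : ((p : ℝ) - Y.card) * ((Y.card : ℝ) ^ 4 / D) ≤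
      (goodPoints Y).card * ((Y.card : ℝ) ^ 4 / D) :=
    mul_le_mul_of_nonneg_right h5 (by positivity)
  have h9 : (Y.card : ℝ) * ((Y.card : ℝ) ^ 4 / D) ≤ (Y.card : ℝ) ^ 5 := by
    have : (Y.card : ℝ) ^ 4 / D ≤ (Y.card : ℝ) ^ 4 := div_le_self (by positivity) hD1
    calc _ ≤ (Y.card : ℝ) * (Y.card : ℝ) ^ 4 := mul_le_mul_of_nonneg_left this (by positivity)
      _ = _ := by ring
  have h10 : (p : ℝ) * ((Y.card : ℝ) ^ 4 / D) = (Y.card : ℝ) ^ 4 * (p / D) := by ring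
  have h11 : (Y.card : ℝ) ^ 4 * (6 * p / p.sqrt) = 6 * (Y.card : ℝ) ^ 4 * (p / p.sqrt) := by ring
  linarith [h4, h8, h9, h10, h11]

end IsDiscreteLog

/-- Number of residues modulo `e` coprime to `e`. -/
lemma card_filter_val_coprime (e : ℕ) [NeZero e] :
    ((univ : Finset (ZMod e)).filter fun c => e.Coprime c.val).card = e.totient := by
  rw [Nat.totient]
  refine card_bij (fun c _ => c.val) ?_ (fun a _ b _ h => ZMod.val_injective e h) ?_
  · intro c hc
    simp only [mem_filter, mem_univ, true_and] at hc
    exact mem_filter.2 ⟨mem_range.2 (ZMod.val_lt c), hc⟩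
  · intro b hb
    simp only [mem_filter, mem_range] at hb
    refine ⟨(b : ZMod e), ?_, ZMod.val_cast_of_lt hb.1⟩
    rw [mem_filter, ZMod.val_cast_of_lt hb.1]
    exact ⟨mem_univ _, hb.2⟩

lemma coprime_mod_iff {e D : ℕ} (h : e ∣ D) (n : ℕ) : e.Coprime (n % D) ↔ e.Coprime n := by
  rw [Nat.coprime_comm, Nat.coprime_comm (n := e), Nat.Coprime, Nat.Coprime,
    ((Nat.mod_modEq n D).of_dvd h).gcd_eq]

lemma card_filter_val_coprime_dvd_le (e q : ℕ) [NeZero (e * q)] (h : e.Coprime q) :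
    ((univ : Finset (ZMod (e * q))).filter fun c => e.Coprime c.val ∧ q ∣ c.val).card ≤
      e.totient := by
  have he : 0 < e := Nat.pos_of_ne_zero (left_ne_zero_of_mul (NeZero.ne (e * q)))
  rw [Nat.totient]
  refine card_le_card_of_injOn (fun c => c.val % e) ?_ ?_
  · intro c hc
    simp only [coe_filter, mem_univ, true_and, Set.mem_ofPred_eq] at hc
    simp only [coe_filter, mem_range, Set.mem_ofPred_eq]
    refine ⟨Nat.mod_lt _ he, ?_⟩
    exact (coprime_mod_iff dvd_rfl _).2 hc.1
  · intro a ha b hb hab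
    simp only [coe_filter, mem_univ, true_and, Set.mem_ofPred_eq] at ha hb
    have h1 : a.val ≡ b.val [MOD e] := hab
    have h2 : a.val ≡ b.val [MOD q] :=
      ((Nat.modEq_zero_iff_dvd).2 ha.2).trans ((Nat.modEq_zero_iff_dvd).2 hb.2).symm
    have h3 := (Nat.modEq_and_modEq_iff_modEq_mul h).1 ⟨h1, h2⟩
    exact ZMod.val_injective _ (h3.eq_of_lt_of_lt (ZMod.val_lt a) (ZMod.val_lt b))

/-- A weighted sieve: if the values `f x y` are equidistributed to moduli `e` and `e * q`, then some
value is coprime to `e` and to all `q`. -/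
lemma exists_coprime_of_discrepancy {α β : Type*} (X : Finset α) (Y : Finset β) (f : α → β → ℕ)
    (e : ℕ) (he : e ≠ 0) (S : Finset ℕ) (hS : ∀ q ∈ S, q.Prime ∧ e.Coprime q) {η : ℝ} (hη : 0 ≤ η)
    (hX : X.Nonempty) (hY : Y.Nonempty)
    (hdisc : ∀ (D : ℕ) [NeZero D], (D = e ∨ ∃ q ∈ S, D = e * q) →
      ∑ c : ZMod D, ((classCount X Y (fun x y => (f x y : ZMod D)) c : ℝ) -
        X.card * Y.card / D) ^ 2 ≤ (η * (X.card * Y.card)) ^ 2)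
    (hnum : ∑ q ∈ S, (1 / (q : ℝ) + e / √e.totient * η) + e / √e.totient * η < 1) :
    ∃ x ∈ X, ∃ y ∈ Y, e.Coprime (f x y) ∧ ∀ q ∈ S, q.Coprime (f x y) := by
  set W : ℝ := X.card * Y.card with hW
  have hW0 : 0 < W := by
    have := hX.card_pos; have := hY.card_pos
    positivity
  have hδ : 0 ≤ η * W := by positivity
  classical
  by_contra! hcon
  have : NeZero e := ⟨he⟩
  have he0 : (0 : ℝ) < e := by exact_mod_cast Nat.pos_of_ne_zero he
  have hφ : (0 : ℝ) < e.totient := by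
    exact_mod_cast Nat.totient_pos.2 (Nat.pos_of_ne_zero he)
  have hcount : ∀ (D : ℕ) [NeZero D] (P : ℕ → Prop) [DecidablePred P],
      (∀ n : ℕ, P ((n : ZMod D).val) ↔ P n) →
      ∑ c ∈ univ.filter (fun c : ZMod D => P c.val),
        (classCount X Y (fun x y => (f x y : ZMod D)) c : ℝ) =
        ((X ×ˢ Y).filter fun z => P (f z.1 z.2)).card := by
    intro D _ P _ hP
    rw [card_eq_sum_card_fiberwise (t := univ.filter (fun c : ZMod D => P c.val))
      (f := fun z => (f z.1 z.2 : ZMod D))]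
    · push_cast
      refine sum_congr rfl fun c hc => ?_
      rw [classCount, filter_filter]
      congr 2
      refine filter_congr fun z _ => ?_
      constructor
      · rintro rfl
        exact ⟨(hP _).1 (mem_filter.1 hc).2, rfl⟩
      · exact fun h => h.2
    · intro z hz
      simp only [coe_filter, Set.mem_ofPred_eq] at hz
      simpa using (hP _).2 hz.2
  set T := ((X ×ˢ Y).filter fun z => e.Coprime (f z.1 z.2)) with hT
  set U : ℕ → Finset (α × β) :=
    fun q => (X ×ˢ Y).filter fun z => e.Coprime (f z.1 z.2) ∧ q ∣ f z.1 z.2 with hU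
  have h1 : e.totient * (W / e) - √e.totient * (η * W) ≤ T.card := by
    have h2 := abs_sum_classCount_sub_le X Y (fun x y => (f x y : ZMod e))
      (univ.filter fun c : ZMod e => e.Coprime c.val) hδ (hdisc e (Or.inl rfl))
    rw [hcount e (fun n => e.Coprime n) (fun n => by rw [ZMod.val_natCast]; exact coprime_mod_iff dvd_rfl n),
      card_filter_val_coprime, abs_le] at h2
    linarith [h2.1]
  have h2 : ∀ q ∈ S, ((U q).card : ℝ) ≤ e.totient * (W / e) * (1 / q) + √e.totient * (η * W) := by
    intro q hq
    have hq0 : q ≠ 0 := (hS q hq).1.ne_zero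
    have : NeZero (e * q) := ⟨mul_ne_zero he hq0⟩
    have h2 := abs_sum_classCount_sub_le X Y (fun x y => (f x y : ZMod (e * q)))
      (univ.filter fun c : ZMod (e * q) => e.Coprime c.val ∧ q ∣ c.val) hδ
      (hdisc (e * q) (Or.inr ⟨q, hq, rfl⟩))
    rw [hcount (e * q) (fun n => e.Coprime n ∧ q ∣ n) (fun n => by
      rw [ZMod.val_natCast, coprime_mod_iff (dvd_mul_right e q), Nat.dvd_mod_iff (dvd_mul_left q e)]),
      abs_le] at h2
    have h3 : (((univ : Finset (ZMod (e * q))).filter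
      fun c => e.Coprime c.val ∧ q ∣ c.val).card : ℝ) ≤ e.totient := by
      exact_mod_cast card_filter_val_coprime_dvd_le e q (hS q hq).2
    have h4 := mul_le_mul_of_nonneg_right h3 (by positivity : 0 ≤ W / ((e * q : ℕ) : ℝ))
    have h5 := mul_le_mul_of_nonneg_right (Real.sqrt_le_sqrt h3) hδ
    have h6 : (e.totient : ℝ) * (W / ((e * q : ℕ) : ℝ)) = e.totient * (W / e) * (1 / q) := by
      push_cast; field_simp
    linarith [h2.2]
  have h3 : T ⊆ S.biUnion U := by
    intro z hz
    simp only [hT, mem_filter, mem_product] at hz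
    obtain ⟨q, hq, hqf⟩ := hcon z.1 hz.1.1 z.2 hz.1.2 hz.2
    replace hqf : q ∣ f z.1 z.2 := by
      by_contra h
      exact hqf ((hS q hq).1.coprime_iff_not_dvd.2 h)
    exact mem_biUnion.2 ⟨q, hq, mem_filter.2 ⟨mem_product.2 hz.1, hz.2, hqf⟩⟩
  have h4 : (T.card : ℝ) ≤ ∑ q ∈ S, ((U q).card : ℝ) := by
    exact_mod_cast (card_le_card h3).trans card_biUnion_le
  have h5 := h4.trans (sum_le_sum h2)
  have h6 : ∀ r : ℝ, e.totient * (W / e) * (r + e / √e.totient * η) =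
      e.totient * (W / e) * r + √e.totient * (η * W) := by
    intro r
    rw [mul_add]
    have h10 : (e.totient : ℝ) / √e.totient = √e.totient := Real.div_sqrt
    calc _ = e.totient * (W / e) * r + (e / e) * (e.totient / √e.totient) * (η * W) := by ring
      _ = _ := by rw [h10, div_self he0.ne', one_mul]
  have h7 : 0 < e.totient * (W / e) := by positivity
  have h8 := mul_lt_mul_of_pos_left hnum h7
  rw [mul_add, mul_sum, sum_congr rfl fun (q : ℕ) _ => h6 (1 / (q : ℝ))] at h8
  have h9 := h6 0
  rw [zero_add, mul_zero, zero_add] at h9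
  linarith

lemma card_mul_le_four_mul_card_coprime (N A : ℕ) :
    (N * A : ℝ) ≤ 4 * (((Ioc 0 N ×ˢ Ioc 0 A).filter fun x => x.1.Coprime x.2).card : ℝ) := by
  have h1 : ((Ioc 0 N ×ˢ Ioc 0 A).filter fun x => ¬ x.1.Coprime x.2) ⊆
      (Ioc 1 A).biUnion fun d => ((Ioc 0 N).filter (d ∣ ·)) ×ˢ ((Ioc 0 A).filter (d ∣ ·)) := by
    intro x hx
    simp only [mem_filter, mem_product, mem_Ioc] at hx
    obtain ⟨⟨⟨h1, h2⟩, h3, h4⟩, h5⟩ := hx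
    simp only [mem_biUnion, mem_product, mem_filter, mem_Ioc]
    have h6 : 0 < x.1.gcd x.2 := Nat.gcd_pos_of_pos_left _ h1
    refine ⟨x.1.gcd x.2, ⟨?_, (Nat.gcd_le_right _ h3).trans h4⟩, ⟨⟨h1, h2⟩, Nat.gcd_dvd_left _ _⟩,
      ⟨h3, h4⟩, Nat.gcd_dvd_right _ _⟩
    exact lt_of_le_of_ne h6 (Ne.symm h5)
  have h2 : ((((Ioc 0 N ×ˢ Ioc 0 A).filter fun x => ¬ x.1.Coprime x.2).card : ℕ) : ℝ) ≤
      ∑ d ∈ Ioc 1 A, (N * A : ℝ) * ((d : ℝ) ^ 2)⁻¹ := by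
    refine (Nat.cast_le.2 ((card_le_card h1).trans card_biUnion_le)).trans ?_
    push_cast
    refine sum_le_sum fun d _ => ?_
    rw [card_product, Nat.Ioc_filter_dvd_card_eq_div, Nat.Ioc_filter_dvd_card_eq_div]
    push_cast
    calc ((N / d : ℕ) : ℝ) * ((A / d : ℕ) : ℝ) ≤ (N / d) * (A / d) := by
          gcongr <;> exact Nat.cast_div_le
      _ = _ := by rw [div_mul_div_comm, ← sq, div_eq_mul_inv]
  have h3 : ∑ d ∈ Ioc 1 A, ((d : ℝ) ^ 2)⁻¹ ≤ 3 / 4 := by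
    rcases lt_or_ge A 2 with h | h
    · rw [Ioc_eq_empty (by omega)]; norm_num
    · rw [← sum_Ioc_consecutive _ (by norm_num : 1 ≤ 2) h]
      have h4 := sum_Ioc_inv_sq_le_sub (α := ℝ) (by norm_num : (2 : ℕ) ≠ 0) h
      have h5 : (0 : ℝ) ≤ (A : ℝ)⁻¹ := by positivity
      have h6 : ∑ d ∈ Ioc (1 : ℕ) 2, ((d : ℝ) ^ 2)⁻¹ = 1 / 4 := by
        rw [show Ioc (1 : ℕ) 2 = ({2} : Finset ℕ) by decide]; norm_num
      rw [h6]
      push_cast at h4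
      linarith
  rw [← mul_sum] at h2
  have h4 := h2.trans (mul_le_mul_of_nonneg_left h3 (by positivity))
  have h5 := card_filter_add_card_filter_not (s := Ioc 0 N ×ˢ Ioc 0 A) (fun x => x.1.Coprime x.2)
  rw [card_product, Nat.card_Ioc, Nat.card_Ioc] at h5
  have h6 : ((((Ioc 0 N ×ˢ Ioc 0 A).filter fun x => x.1.Coprime x.2).card : ℕ) : ℝ) +
    ((((Ioc 0 N ×ˢ Ioc 0 A).filter fun x => ¬ x.1.Coprime x.2).card : ℕ) : ℝ) = N * A := by
    exact_mod_cast h5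
  linarith

lemma injOn_div_coprime {p : ℕ} [Fact p.Prime] {N A : ℕ} (hNA : N * A < p) (hA : A < p) :
    Set.InjOn (fun x : ℕ × ℕ => (x.1 : ZMod p) / (x.2 : ZMod p))
      ((Ioc 0 N ×ˢ Ioc 0 A).filter fun x => x.1.Coprime x.2) := by
  rintro ⟨n, a⟩ hx ⟨n', a'⟩ hy h
  simp only [coe_filter, mem_product, mem_Ioc, Set.mem_ofPred_eq] at hx hy h
  obtain ⟨⟨⟨hn0, hn⟩, ha0, ha⟩, hna⟩ := hx
  obtain ⟨⟨⟨hn0', hn'⟩, ha0', ha'⟩, hna'⟩ := hy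
  have hne : ∀ b : ℕ, 0 < b → b ≤ A → (b : ZMod p) ≠ 0 := by
    intro b hb hbA h0
    exact absurd (Nat.le_of_dvd hb ((ZMod.natCast_eq_zero_iff _ _).1 h0)) (by omega)
  rw [div_eq_div_iff (hne a ha0 ha) (hne a' ha0' ha')] at h
  have h1 : ((n * a' : ℕ) : ZMod p) = ((n' * a : ℕ) : ZMod p) := by exact_mod_cast h
  rw [ZMod.natCast_eq_natCast_iff] at h1
  have h2 : n * a' = n' * a := h1.eq_of_lt_of_lt
    ((Nat.mul_le_mul hn ha').trans_lt hNA) ((Nat.mul_le_mul hn' ha).trans_lt hNA)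
  have h3 : a ∣ a' := hna.symm.dvd_of_dvd_mul_left (Dvd.intro_left n' h2.symm)
  have h4 : a' ∣ a := hna'.symm.dvd_of_dvd_mul_left (Dvd.intro_left n h2)
  have h5 := Nat.dvd_antisymm h3 h4
  subst h5
  rw [Nat.eq_of_mul_eq_mul_right ha0 h2]

lemma totient_prod_primes (K : Finset ℕ) (hK : ∀ r ∈ K, r.Prime) :
    (∏ r ∈ K, r).totient = ∏ r ∈ K, (r - 1) := by
  induction K using Finset.induction_on with
  | empty => simp
  | insert q K hq ih =>
    rw [prod_insert hq, prod_insert hq, Nat.totient_mul, ih fun r hr => hK r (mem_insert_of_mem hr),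
      Nat.totient_prime (hK q (mem_insert_self q K))]
    refine Nat.Coprime.prod_right fun r hr => ?_
    refine (Nat.coprime_primes (hK q (mem_insert_self q K)) (hK r (mem_insert_of_mem hr))).2 ?_
    rintro rfl
    exact hq hr

lemma fourth_power_scale {Q p s X : ℝ} (hQ : 1000 ≤ Q) (hp : p < 16 * (Q + 1) ^ 4)
    (hs : 4 * Q ^ 2 ≤ s) (hX : (2 * Q ^ 2 - 2) * Q ≤ 4 * X) :
    3 * (2 * Q) ^ 2 * p + 6 * (2 * Q) ^ 4 * (p / s) + (2 * Q) ^ 5 ≤ 80 / Q * X * (2 * Q) ^ 4 := by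
  have hQ0 : 0 < Q := by linarith
  have h1 : (Q + 1) ^ 4 ≤ 1.005 * Q ^ 4 := by
    have h2 : Q + 1 ≤ 1.001 * Q := by linarith
    calc (Q + 1) ^ 4 ≤ (1.001 * Q) ^ 4 := pow_le_pow_left₀ (by linarith) h2 4
      _ = 1.001 ^ 4 * Q ^ 4 := by ring
      _ ≤ _ := by gcongr; norm_num
  have h2 : p ≤ 16.08 * Q ^ 4 := by linarith
  have h3 : p / s ≤ 4.02 * Q ^ 2 := by
    rw [div_le_iff₀ (lt_of_lt_of_le (by positivity) hs)]
    calc p ≤ 16.08 * Q ^ 4 := h2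
      _ = 4.02 * Q ^ 2 * (4 * Q ^ 2) := by ring
      _ ≤ _ := by gcongr
  calc _ ≤ 3 * (2 * Q) ^ 2 * (16.08 * Q ^ 4) + 6 * (2 * Q) ^ 4 * (4.02 * Q ^ 2) + (2 * Q) ^ 5 := by
        gcongr
    _ ≤ 80 / Q * ((2 * Q ^ 2 - 2) * Q / 4) * (2 * Q) ^ 4 := by
        have h4 : 80 / Q * ((2 * Q ^ 2 - 2) * Q / 4) * (2 * Q) ^ 4 = 640 * Q ^ 6 - 640 * Q ^ 4 := by
          field_simp; ring
        rw [h4]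
        have h5 : 1000 * Q ^ 5 ≤ Q ^ 6 := by
          calc 1000 * Q ^ 5 ≤ Q * Q ^ 5 := by gcongr
            _ = _ := by ring
        have h6 : 1000 * Q ^ 4 ≤ Q ^ 5 := by
          calc 1000 * Q ^ 4 ≤ Q * Q ^ 4 := by gcongr
            _ = _ := by ring
        have h7 : 0 < Q ^ 5 := by positivity
        nlinarith
    _ ≤ _ := by gcongr; linarith

/-- A primitive root is found once the sieve inequality holds for some splitting of the primes
dividing `p - 1`. -/
lemma leastPrimitiveRoot_le_of_sieve {p : ℕ} (hp : p.Prime) {Q : ℕ} (hQ : 1000 ≤ Q)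
    (hQp : 16 * Q ^ 4 ≤ p) (hpQ : p < 16 * (Q + 1) ^ 4) {η : ℝ} (hη : 0 ≤ η)
    (hηQ : η ^ 4 = 80 / Q) {z : ℕ} (hz : 2 ≤ z)
    (hnum : ∑ q ∈ (p - 1).primeFactors.filter (z < ·), (1 / (q : ℝ) +
        (∏ r ∈ (p - 1).primeFactors.filter (· ≤ z), (r : ℝ) / √((r : ℝ) - 1)) * η) +
      (∏ r ∈ (p - 1).primeFactors.filter (· ≤ z), (r : ℝ) / √((r : ℝ) - 1)) * η < 1) :
    leastPrimitiveRoot p ≤ 4 * Q ^ 2 - 2 := by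
  have : Fact p.Prime := ⟨hp⟩
  obtain ⟨g, ind, hg⟩ := exists_isDiscreteLog p
  have hQ4 : 1000 ^ 3 * Q ≤ Q ^ 4 := by
    calc 1000 ^ 3 * Q ≤ Q ^ 3 * Q := by gcongr
      _ = Q ^ 4 := by ring
  have hp3 : p ≠ 2 := by omega
  obtain ⟨N, hN⟩ : ∃ N, N + 2 = 2 * Q ^ 2 := ⟨2 * Q ^ 2 - 2, by
    have : 1 ≤ Q ^ 2 := Nat.one_le_pow _ _ (by omega)
    omega⟩
  have hQQ : 4 * Q ^ 2 < 16 * Q ^ 4 := by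
    have : 1 ≤ Q ^ 2 := Nat.one_le_pow _ _ (by omega)
    have h2 : Q ^ 4 = Q ^ 2 * Q ^ 2 := by ring
    nlinarith
  have hNQ : N * Q < p := by
    have h1 : N ≤ 2 * Q ^ 2 := by omega
    calc N * Q ≤ 2 * Q ^ 2 * Q := by gcongr
      _ ≤ 2 * Q ^ 2 * Q ^ 2 := by gcongr; exact Nat.le_self_pow (by norm_num) Q
      _ = 2 * Q ^ 4 := by ring
      _ < p := by omega
  set X := (Ioc 0 N ×ˢ Ioc 0 Q).filter fun x => x.1.Coprime x.2 with hX
  set Y := (Ioc 0 (2 * Q)).image (fun b : ℕ => (b : ZMod p)) with hY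
  have hYc : Y.card = 2 * Q := by
    rw [hY, card_image_of_injOn, Nat.card_Ioc, Nat.sub_zero]
    intro b hb b' hb' h
    simp only [coe_Ioc, Set.mem_Ioc] at hb hb'
    exact ((ZMod.natCast_eq_natCast_iff _ _ _).1 h).eq_of_lt_of_lt (by omega) (by omega)
  set u : ℕ × ℕ → ZMod p := fun x => x.1 with hu
  set v : ℕ × ℕ → ZMod p := fun x => x.2 with hv
  have hXmem : ∀ x ∈ X, (0 < x.1 ∧ x.1 ≤ N) ∧ 0 < x.2 ∧ x.2 ≤ Q := by
    intro x hx
    have := (mem_filter.1 hx).1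
    simpa only [mem_product, mem_Ioc] using this
  have hval : ∀ x ∈ X, ∀ b, b ≤ 2 * Q → 0 < x.1 + x.2 * b ∧ x.1 + x.2 * b ≤ 4 * Q ^ 2 - 2 := by
    intro x hx b hb
    obtain ⟨⟨h1, h2⟩, h3, h4⟩ := hXmem x hx
    refine ⟨by omega, ?_⟩
    have : x.2 * b ≤ Q * (2 * Q) := Nat.mul_le_mul h4 hb
    have h5 : Q * (2 * Q) = 2 * Q ^ 2 := by ring
    omega
  have hv0 : ∀ x ∈ X, v x ≠ 0 := by
    intro x hx h
    obtain ⟨_, h3, h4⟩ := hXmem x hx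
    exact absurd (Nat.le_of_dvd h3 ((ZMod.natCast_eq_zero_iff _ _).1 h)) (by omega)
  have huv : ∀ x ∈ X, ∀ y ∈ Y, u x + v x * y ≠ 0 := by
    intro x hx y hy h
    obtain ⟨b, hb, rfl⟩ := mem_image.1 hy
    obtain ⟨h1, h2⟩ := hval x hx b (mem_Ioc.1 hb).2
    have h3 : ((x.1 + x.2 * b : ℕ) : ZMod p) = 0 := by push_cast; exact h
    exact absurd (Nat.le_of_dvd h1 ((ZMod.natCast_eq_zero_iff _ _).1 h3)) (by omega)
  have hXc : ((2 * (Q : ℝ) ^ 2 - 2) * Q) ≤ 4 * (X.card : ℝ) := by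
    have h1 := card_mul_le_four_mul_card_coprime N Q
    have h2 : (N : ℝ) = 2 * (Q : ℝ) ^ 2 - 2 := by
      rw [eq_sub_iff_add_eq]; exact_mod_cast hN
    rwa [h2] at h1
  have hQr : (1000 : ℝ) ≤ Q := by exact_mod_cast hQ
  have hXpos : (0 : ℝ) < X.card := by nlinarith
  set K := (p - 1).primeFactors.filter (· ≤ z) with hK
  set S := (p - 1).primeFactors.filter (z < ·) with hS
  set e := ∏ r ∈ K, r with he
  have hKp : ∀ r ∈ K, r.Prime := fun r hr => Nat.prime_of_mem_primeFactors (mem_filter.1 hr).1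
  have hSp : ∀ q ∈ S, q.Prime := fun r hr => Nat.prime_of_mem_primeFactors (mem_filter.1 hr).1
  have hp1 : p - 1 ≠ 0 := by have := hp.two_le; omega
  have he0 : e ≠ 0 := prod_ne_zero_iff.2 fun r hr => (hKp r hr).ne_zero
  have h2K : 2 ∈ K := by
    refine mem_filter.2 ⟨Nat.mem_primeFactors.2 ⟨Nat.prime_two, ?_, hp1⟩, hz⟩
    exact (hp.even_sub_one hp3).two_dvd
  have h2e : 2 ∣ e := dvd_prod_of_mem _ h2K
  have hep : e ∣ p - 1 := (prod_dvd_prod_of_subset _ _ _ (filter_subset _ _)).trans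
    (Nat.prod_primeFactors_dvd _)
  have hSe : ∀ q ∈ S, e.Coprime q := by
    intro q hq
    refine Nat.Coprime.prod_left fun r hr => (Nat.coprime_primes (hKp r hr) (hSp q hq)).2 ?_
    have h1 := (mem_filter.1 hr).2
    have h2 := (mem_filter.1 hq).2
    omega
  have hφ : (e : ℝ) / √(e.totient) = ∏ r ∈ K, (r : ℝ) / √((r : ℝ) - 1) := by
    have h1 : e.totient = ∏ r ∈ K, (r - 1) := totient_prod_primes K hKp
    have h2 : ((e.totient : ℕ) : ℝ) = ∏ r ∈ K, ((r : ℝ) - 1) := by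
      rw [h1]
      push_cast
      refine prod_congr rfl fun r hr => ?_
      rw [Nat.cast_sub (hKp r hr).one_le, Nat.cast_one]
    rw [h2, Real.sqrt_prod, prod_div_distrib, he]
    · push_cast; rfl
    · intro r hr
      have : (1 : ℝ) ≤ r := by exact_mod_cast (hKp r hr).one_le
      linarith
  have hsq : 4 * Q ^ 2 ≤ p.sqrt := by
    rw [Nat.le_sqrt]
    refine le_trans (le_of_eq ?_) hQp
    ring
  have hdisc : ∀ (D : ℕ) [NeZero D], (D = e ∨ ∃ q ∈ S, D = e * q) →
      ∑ c : ZMod D, ((classCount X Y (fun x y => (ind (u x + v x * y) : ZMod D)) c : ℝ) -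
        X.card * Y.card / D) ^ 2 ≤ (η * (X.card * Y.card)) ^ 2 := by
    intro D _ hD
    have hDp : D ∣ p - 1 := by
      rcases hD with rfl | ⟨q, hq, rfl⟩
      · exact hep
      · exact (hSe q hq).mul_dvd_of_dvd_of_dvd hep
          (Nat.dvd_of_mem_primeFactors (mem_filter.1 hq).1)
    have h2D : 2 ≤ D := by
      refine Nat.le_of_dvd (Nat.pos_of_ne_zero (NeZero.ne D)) ?_
      rcases hD with rfl | ⟨q, hq, rfl⟩
      · exact h2e
      · exact h2e.mul_right q
    obtain ⟨k, hk⟩ := hDp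
    have h1 := hg.sq_discrepancy_le (by omega) h2D (by omega : D * k + 1 = p) X Y u v hv0 huv
      (injOn_div_coprime hNQ (by omega))
    have h2 := fourth_power_scale (p := (p : ℝ)) (s := (p.sqrt : ℝ)) hQr (by
      have h := Nat.cast_lt (α := ℝ).2 hpQ
      rwa [Nat.cast_mul, Nat.cast_pow, Nat.cast_add, Nat.cast_one, Nat.cast_ofNat] at h)
      (by
        have h := Nat.cast_le (α := ℝ).2 hsq
        rwa [Nat.cast_mul, Nat.cast_pow, Nat.cast_ofNat] at h) hXc
    refine le_of_sq_le_sq (h1.trans ?_) (sq_nonneg _)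
    rw [hYc]
    push_cast
    refine (mul_le_mul_of_nonneg_left h2 (pow_nonneg (Nat.cast_nonneg _) 3)).trans_eq ?_
    rw [← hηQ]; ring
  have hYne : Y.Nonempty := card_pos.1 (by omega)
  have hXne : X.Nonempty := card_pos.1 (by exact_mod_cast hXpos)
  obtain ⟨x, hx, y, hy, h1, h2⟩ := exists_coprime_of_discrepancy X Y
    (fun x y => ind (u x + v x * y)) e he0 S (fun q hq => ⟨hSp q hq, hSe q hq⟩) hη hXne hYne hdisc
    (by rw [hφ]; exact hnum)
  obtain ⟨b, hb, rfl⟩ := mem_image.1 hy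
  obtain ⟨h3, h4⟩ := hval x hx b (mem_Ioc.1 hb).2
  refine le_trans (Nat.sInf_le ⟨h3, ?_⟩) h4
  have h5 : ((x.1 + x.2 * b : ℕ) : ZMod p) = u x + v x * b := by push_cast; rfl
  rw [h5, ← hg.pow_eq _ (huv x hx _ hy), orderOf_units, ← hg.orderOf_eq]
  refine Nat.Coprime.orderOf_pow ?_
  rw [hg.orderOf_eq]
  refine Nat.coprime_of_dvd fun r hr hr1 hr2 => ?_
  have hrm : r ∈ (p - 1).primeFactors := Nat.mem_primeFactors.2 ⟨hr, hr1, hp1⟩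
  rcases le_or_gt r z with hrz | hrz
  · have h6 : r ∣ e := dvd_prod_of_mem _ (mem_filter.2 ⟨hrm, hrz⟩)
    exact hr.not_dvd_one (h1 ▸ Nat.dvd_gcd h6 hr2)
  · exact (hr.coprime_iff_not_dvd.1 (h2 r (mem_filter.2 ⟨hrm, hrz⟩))) hr2

/-- A linear programming bound for sums over the prime divisors of `m`: the weight `1 / q + w` is
compared with the multiple of `log q` that it crosses at `q = y`. -/
lemma sum_primeFactors_le {m z y : ℕ} (hm : m ≠ 0) (hy : 2 ≤ y) (T : Finset ℕ)
    (hT : ∀ q ∈ T, 2 ≤ q ∧ q < y) (hprime : ∀ q : ℕ, q.Prime → z < q → q < y → q ∈ T) {w : ℝ}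
    (hw : 0 ≤ w) :
    ∑ q ∈ m.primeFactors.filter (z < ·), (1 / (q : ℝ) + w) ≤
      ∑ q ∈ T, (1 / (q : ℝ) + w) +
        (1 / (y : ℝ) + w) / Real.log y * (Real.log m - ∑ q ∈ T, Real.log q) := by
  set S := m.primeFactors.filter (z < ·) with hS
  set c := (1 / (y : ℝ) + w) / Real.log y with hc
  have hlogy : 0 < Real.log y := Real.log_pos (by exact_mod_cast hy)
  have hy0 : (0 : ℝ) < y := by exact_mod_cast (by omega : 0 < y)
  have hc0 : 0 ≤ c := by positivity
  have hcy : c * Real.log y = 1 / (y : ℝ) + w := div_mul_cancel₀ _ hlogy.ne'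
  have hSp : ∀ q ∈ S, q.Prime := fun r hr => Nat.prime_of_mem_primeFactors (mem_filter.1 hr).1
  have hlow : ∀ q ∈ T, 0 ≤ 1 / (q : ℝ) + w - c * Real.log q := by
    intro q hq
    obtain ⟨h1, h2⟩ := hT q hq
    have hq0 : (0 : ℝ) < q := by exact_mod_cast (by omega : 0 < q)
    have hqy : (q : ℝ) ≤ y := by exact_mod_cast h2.le
    have h3 : c * Real.log q ≤ c * Real.log y :=
      mul_le_mul_of_nonneg_left (Real.log_le_log hq0 hqy) hc0
    have h4 : 1 / (y : ℝ) ≤ 1 / q := one_div_le_one_div_of_le hq0 hqy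
    linarith
  have hhigh : ∀ q ∈ S, q ∉ T → 1 / (q : ℝ) + w - c * Real.log q ≤ 0 := by
    intro q hq hqT
    have h2 : y ≤ q := by
      by_contra h
      exact hqT (hprime q (hSp q hq) (mem_filter.1 hq).2 (not_le.1 h))
    have hqy : (y : ℝ) ≤ q := by exact_mod_cast h2
    have h3 : c * Real.log y ≤ c * Real.log q :=
      mul_le_mul_of_nonneg_left (Real.log_le_log hy0 hqy) hc0
    have h4 : 1 / (q : ℝ) ≤ 1 / y := one_div_le_one_div_of_le hy0 hqy
    linarith
  have h1 : ∑ q ∈ S, (1 / (q : ℝ) + w - c * Real.log q) ≤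
      ∑ q ∈ T, (1 / (q : ℝ) + w - c * Real.log q) := by
    rw [← sum_filter_add_sum_filter_not S (· ∈ T)]
    have h2 : ∑ q ∈ S.filter (· ∉ T), (1 / (q : ℝ) + w - c * Real.log q) ≤ 0 :=
      sum_nonpos fun q hq => hhigh q (mem_filter.1 hq).1 (mem_filter.1 hq).2
    have h3 : ∑ q ∈ S.filter (· ∈ T), (1 / (q : ℝ) + w - c * Real.log q) ≤
        ∑ q ∈ T, (1 / (q : ℝ) + w - c * Real.log q) :=
      sum_le_sum_of_subset_of_nonneg (fun q hq => (mem_filter.1 hq).2) fun q hq _ => hlow q hq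
    linarith
  have h2 : ∑ q ∈ S, Real.log q ≤ Real.log m := by
    rw [← Real.log_prod fun q hq => by exact_mod_cast (hSp q hq).ne_zero]
    have h3 : ∏ q ∈ S, q ≤ m := Nat.le_of_dvd (Nat.pos_of_ne_zero hm)
      ((prod_dvd_prod_of_subset _ _ _ (filter_subset _ _)).trans (Nat.prod_primeFactors_dvd m))
    refine Real.log_le_log (prod_pos fun q hq => by exact_mod_cast (hSp q hq).pos) ?_
    rw [← Nat.cast_prod]
    exact Nat.cast_le.2 h3
  rw [sum_sub_distrib, sum_sub_distrib, ← mul_sum, ← mul_sum] at h1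
  have h3 := mul_le_mul_of_nonneg_left h2 hc0
  rw [mul_sub]
  linarith

lemma sum_primeFactors_lt_one_of_list {m z y : ℕ} (hm0 : m ≠ 0) (hy : 2 ≤ y) (l : List ℕ)
    (hnodup : l.Nodup) (hl : ∀ q ∈ l, 2 ≤ q ∧ q < y)
    (hprime : ∀ q : ℕ, q.Prime → z < q → q < y → q ∈ l) {w : ℝ} (hw : 0 ≤ w) {n t a b A : ℕ}
    (hm : m ≤ 10 ^ (t + n)) (ht : 10 ^ t ≤ l.prod) (ha : a ≠ 0) (hab : 10 ^ a ≤ y ^ b)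
    (hA : (l.map fun q => 10 ^ 6 / q + 1).sum ≤ A)
    (hnum : (A : ℝ) / 10 ^ 6 + l.length * w + (1 / (y : ℝ) + w) * (n * (b / a)) + w < 1) :
    ∑ q ∈ m.primeFactors.filter (z < ·), (1 / (q : ℝ) + w) + w < 1 := by
  have h1 := sum_primeFactors_le hm0 hy l.toFinset (fun q hq => hl q (List.mem_toFinset.1 hq))
    (fun q h1 h2 h3 => List.mem_toFinset.2 (hprime q h1 h2 h3)) hw
  have hlogy : 0 < Real.log y := Real.log_pos (by exact_mod_cast hy)
  have hy0 : (0 : ℝ) < y := by exact_mod_cast (by omega : 0 < y)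
  have ha0 : (0 : ℝ) < a := by exact_mod_cast Nat.pos_of_ne_zero ha
  have hlog10 : 0 < Real.log 10 := Real.log_pos (by norm_num)
  have h2 : ∑ q ∈ l.toFinset, (1 / (q : ℝ) + w) ≤ A / 10 ^ 6 + l.length * w := by
    rw [sum_add_distrib, sum_const, nsmul_eq_mul, List.toFinset_card_of_nodup hnodup]
    refine add_le_add ?_ le_rfl
    rw [le_div_iff₀ (by positivity), sum_mul]
    refine le_trans ?_ (Nat.cast_le.2 hA)
    rw [← List.sum_toFinset _ hnodup]
    push_cast
    refine sum_le_sum fun q hq => ?_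
    have hq0 : (0 : ℝ) < q := by
      exact_mod_cast (by have := (hl q (List.mem_toFinset.1 hq)).1; omega : 0 < q)
    have h3 : 10 ^ 6 < q * (10 ^ 6 / q + 1) := by
      exact Nat.lt_mul_div_succ _ (by exact_mod_cast hq0)
    have h4 : (10 ^ 6 : ℝ) ≤ q * ((10 ^ 6 / q : ℕ) + 1) := by exact_mod_cast h3.le
    rw [one_div, inv_mul_le_iff₀ hq0]
    exact h4
  have h3 : (t : ℝ) * Real.log 10 ≤ ∑ q ∈ l.toFinset, Real.log q := by
    rw [← Real.log_prod fun q hq => by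
      have := (hl q (List.mem_toFinset.1 hq)).1
      exact_mod_cast (by omega : q ≠ 0)]
    rw [← Real.log_pow]
    refine Real.log_le_log (by positivity) ?_
    have h4 : ∏ q ∈ l.toFinset, q = l.prod := by
      rw [List.prod_toFinset _ hnodup, List.map_id']
    rw [← h4] at ht
    rw [← Nat.cast_prod]
    exact_mod_cast ht
  have h4 : Real.log m ≤ (t + n : ℕ) * Real.log 10 := by
    rw [← Real.log_pow]
    refine Real.log_le_log (by exact_mod_cast Nat.pos_of_ne_zero hm0) ?_
    exact_mod_cast hm
  have h5 : a * Real.log 10 ≤ b * Real.log y := by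
    rw [← Real.log_pow, ← Real.log_pow]
    refine Real.log_le_log (by positivity) ?_
    exact_mod_cast hab
  have h6 : (1 / (y : ℝ) + w) / Real.log y * (Real.log m - ∑ q ∈ l.toFinset, Real.log q) ≤
      (1 / (y : ℝ) + w) * (n * (b / a)) := by
    have h7 : Real.log m - ∑ q ∈ l.toFinset, Real.log q ≤ n * Real.log 10 := by
      push_cast at h4
      linarith
    have h8 : Real.log 10 ≤ (b / a) * Real.log y := by
      rw [div_mul_eq_mul_div, le_div_iff₀ ha0]
      linarith
    calc _ ≤ (1 / (y : ℝ) + w) / Real.log y * (n * ((b / a) * Real.log y)) := by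
          gcongr
          exact h7.trans (by gcongr)
      _ = _ := by field_simp
  linarith

lemma sum_primeFactors_mono {m z : ℕ} {v w : ℝ} (hvw : v ≤ w)
    (h : ∑ q ∈ m.primeFactors.filter (z < ·), (1 / (q : ℝ) + w) + w < 1) :
    ∑ q ∈ m.primeFactors.filter (z < ·), (1 / (q : ℝ) + v) + v < 1 := by
  refine lt_of_le_of_lt ?_ h
  gcongr

/-- The weight of the small primes is at most that of all primes up to `z`. -/
lemma sq_prod_primeFactors_le (m : ℕ) {z : ℕ} (P : Finset ℕ) (hP : ∀ r ∈ P, 2 ≤ r)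
    (hprime : ∀ r : ℕ, r.Prime → r ≤ z → r ∈ P) :
    (∏ r ∈ m.primeFactors.filter (· ≤ z), (r : ℝ) / √((r : ℝ) - 1)) ^ 2 ≤
      ∏ r ∈ P, (r : ℝ) ^ 2 / ((r : ℝ) - 1) := by
  have hone : ∀ r ∈ P, (1 : ℝ) ≤ (r : ℝ) ^ 2 / ((r : ℝ) - 1) := by
    intro r hr
    have h2 : (2 : ℝ) ≤ r := by exact_mod_cast hP r hr
    rw [le_div_iff₀ (by linarith)]
    nlinarith
  have hsub : m.primeFactors.filter (· ≤ z) ⊆ P := fun r hr =>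
    hprime r (Nat.prime_of_mem_primeFactors (mem_filter.1 hr).1) (mem_filter.1 hr).2
  have h1 : (∏ r ∈ m.primeFactors.filter (· ≤ z), (r : ℝ) / √((r : ℝ) - 1)) ^ 2 =
      ∏ r ∈ m.primeFactors.filter (· ≤ z), (r : ℝ) ^ 2 / ((r : ℝ) - 1) := by
    rw [← prod_pow]
    refine prod_congr rfl fun r hr => ?_
    have h2 : (2 : ℝ) ≤ r := by exact_mod_cast hP r (hsub hr)
    rw [div_pow, Real.sq_sqrt (by linarith)]
  rw [h1, ← prod_sdiff hsub]
  refine le_mul_of_one_le_left (prod_nonneg fun r hr => zero_le_one.trans (hone r (hsub hr))) ?_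
  exact one_le_prod fun r hr => hone r (mem_sdiff.1 hr).1

/-- The integers in `(z, y)` without a prime factor up to `43` other than themselves. -/
def sieveList (z y : ℕ) : List ℕ :=
  (List.range y).filter fun n => decide (z < n) &&
    [2, 3, 5, 7, 11, 13, 17, 19, 23, 29, 31, 37, 41, 43].all fun d => n % d != 0 || n == d

lemma mem_sieveList_of_prime {z y q : ℕ} (hq : q.Prime) (hz : z < q) (hy : q < y) :
    q ∈ sieveList z y := by
  simp only [sieveList, List.mem_filter, List.mem_range, Bool.and_eq_true, decide_eq_true_eq,
    List.all_eq_true, Bool.or_eq_true, bne_iff_ne, beq_iff_eq]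
  refine ⟨hy, hz, fun d hd => ?_⟩
  by_contra! h
  have h1 : d ∣ q := Nat.dvd_of_mod_eq_zero h.1
  rcases (Nat.dvd_prime hq).1 h1 with rfl | rfl
  · simp at hd
  · exact h.2 rfl

lemma nodup_sieveList (z y : ℕ) : (sieveList z y).Nodup := List.nodup_range.filter _

lemma mem_sieveList {z y q : ℕ} (h : q ∈ sieveList z y) : z < q ∧ q < y := by
  simp only [sieveList, List.mem_filter, List.mem_range, Bool.and_eq_true, decide_eq_true_eq] at h
  exact ⟨h.2.1, h.1⟩

/-- The sieve inequality for `m`, with the primes up to `z` left out. -/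
def SieveCondition (m : ℕ) (η : ℝ) (z : ℕ) : Prop :=
  ∑ q ∈ m.primeFactors.filter (z < ·), (1 / (q : ℝ) +
      (∏ r ∈ m.primeFactors.filter (· ≤ z), (r : ℝ) / √((r : ℝ) - 1)) * η) +
    (∏ r ∈ m.primeFactors.filter (· ≤ z), (r : ℝ) / √((r : ℝ) - 1)) * η < 1

lemma sieveCondition_of_bounds {m z y : ℕ} (hm0 : m ≠ 0) (hz : 2 ≤ z) (hy : 2 ≤ y) (P : Finset ℕ)
    (hP : ∀ r ∈ P, 2 ≤ r) (hprime : ∀ r : ℕ, r.Prime → r ≤ z → r ∈ P) {η κ η₀ : ℝ} (hη : 0 ≤ η)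
    (hηm : η ^ 16 * m ≤ 7 * 10 ^ 8) (hκ0 : 0 ≤ κ) (hκ : ∏ r ∈ P, (r : ℝ) ^ 2 / ((r : ℝ) - 1) ≤ κ ^ 2)
    (hη₀ : 0 ≤ η₀) (hη₀m : 7 * 10 ^ 8 ≤ η₀ ^ 16 * m) {n t a b A len : ℕ}
    (hm : m ≤ 10 ^ (t + n)) (ht : 10 ^ t ≤ (sieveList z y).prod) (ha : a ≠ 0)
    (hab : 10 ^ a ≤ y ^ b) (hA : ((sieveList z y).map fun q => 10 ^ 6 / q + 1).sum ≤ A)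
    (hlen : (sieveList z y).length ≤ len)
    (hnum : (A : ℝ) / 10 ^ 6 + len * (κ * η₀) + (1 / (y : ℝ) + κ * η₀) * (n * (b / a)) + κ * η₀
      < 1) : SieveCondition m η z := by
  have hm1 : (0 : ℝ) < m := by exact_mod_cast Nat.pos_of_ne_zero hm0
  have h1 : η ≤ η₀ := by
    have h2 : η ^ 16 ≤ η₀ ^ 16 := le_of_mul_le_mul_right (hηm.trans hη₀m) hm1
    exact le_of_pow_le_pow_left₀ (by norm_num) hη₀ h2
  have h2 : (∏ r ∈ m.primeFactors.filter (· ≤ z), (r : ℝ) / √((r : ℝ) - 1)) ≤ κ :=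
    le_of_sq_le_sq ((sq_prod_primeFactors_le m P hP hprime).trans hκ) hκ0
  have hw : 0 ≤ κ * η₀ := by positivity
  refine sum_primeFactors_mono (mul_le_mul h2 h1 hη hκ0)
    (sum_primeFactors_lt_one_of_list hm0 hy (sieveList z y) (nodup_sieveList z y)
      (fun q hq => ⟨?_, (mem_sieveList hq).2⟩) (fun q h1 h2 h3 => mem_sieveList_of_prime h1 h2 h3)
      hw hm ht ha hab hA ?_)
  · have := (mem_sieveList hq).1
    omega
  · refine lt_of_le_of_lt ?_ hnum
    gcongr

lemma sieveCondition_five {m : ℕ} {η : ℝ} (hη : 0 ≤ η) (hηm : η ^ 16 * m ≤ 7 * 10 ^ 8)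
    (hlow : 3669 * 10 ^ 68 ≤ m) (hm : m ≤ 10 ^ 82) : SieveCondition m η 5 := by
  have hm0 : m ≠ 0 := (lt_of_lt_of_le (by positivity) hlow).ne'
  have hm1 : (3669 * 10 ^ 68 : ℝ) ≤ m := by exact_mod_cast hlow
  refine sieveCondition_of_bounds (y := 211) (κ := 10.607) (η₀ := 0.00012025) (t := 80) (n := 2)
    (a := 232) (b := 100) (A := 915725) (len := 43) hm0 (by norm_num) (by norm_num)
    {2, 3, 5} (by decide) (fun r hr h => ?_) hη hηm (by norm_num)
    (by norm_num) (by norm_num) ?_ hm (by decide +kernel) (by norm_num) (by norm_num)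
    (by decide +kernel) (by decide +kernel) (by norm_num)
  · interval_cases r <;> revert hr <;> decide
  · calc (7 * 10 ^ 8 : ℝ) ≤ (0.00012025) ^ 16 * (3669 * 10 ^ 68) := by norm_num
      _ ≤ _ := by gcongr

lemma sieveCondition_seven {m : ℕ} {η : ℝ} (hη : 0 ≤ η) (hηm : η ^ 16 * m ≤ 7 * 10 ^ 8)
    (hlow : 10 ^ 82 ≤ m) (hm : m ≤ 10 ^ 120) : SieveCondition m η 7 := by
  have hm0 : m ≠ 0 := (lt_of_lt_of_le (by positivity) hlow).ne'
  have hm1 : (10 ^ 82 : ℝ) ≤ m := by exact_mod_cast hlow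
  refine sieveCondition_of_bounds (y := 220) (κ := 30.32) (η₀ := 0.0000269) (t := 81) (n := 39)
    (a := 234) (b := 100) (A := 777607) (len := 43) hm0 (by norm_num) (by norm_num)
    {2, 3, 5, 7} (by decide) (fun r hr h => ?_) hη hηm (by norm_num)
    (by norm_num) (by norm_num) ?_ hm (by decide +kernel) (by norm_num) (by norm_num)
    (by decide +kernel) (by decide +kernel) (by norm_num)
  · interval_cases r <;> revert hr <;> decide
  · calc (7 * 10 ^ 8 : ℝ) ≤ (0.0000269) ^ 16 * (10 ^ 82) := by norm_num
      _ ≤ _ := by gcongr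

set_option exponentiation.threshold 3000 in
lemma sieveCondition_eleven {m : ℕ} {η : ℝ} (hη : 0 ≤ η) (hηm : η ^ 16 * m ≤ 7 * 10 ^ 8)
    (hlow : 10 ^ 120 ≤ m) (hm : m ≤ 10 ^ 400) : SieveCondition m η 11 := by
  have hm0 : m ≠ 0 := (lt_of_lt_of_le (by positivity) hlow).ne'
  have hm1 : (10 ^ 120 : ℝ) ≤ m := by exact_mod_cast hlow
  refine sieveCondition_of_bounds (y := 700) (κ := 105.5) (η₀ := 1.13 / 10 ^ 7) (t := 286) (n := 114)
    (a := 284) (b := 100) (A := 879869) (len := 120) hm0 (by norm_num) (by norm_num)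
    {2, 3, 5, 7, 11} (by decide) (fun r hr h => ?_) hη hηm (by norm_num)
    (by norm_num) (by norm_num) ?_ hm (by decide +kernel) (by norm_num) (by norm_num)
    (by decide +kernel) (by decide +kernel) (by norm_num)
  · interval_cases r <;> revert hr <;> decide
  · calc (7 * 10 ^ 8 : ℝ) ≤ (1.13 / 10 ^ 7) ^ 16 * (10 ^ 120) := by norm_num
      _ ≤ _ := by gcongr

set_option exponentiation.threshold 3000 in
lemma sieveCondition_thirtyOne {m : ℕ} {η : ℝ} (hη : 0 ≤ η) (hηm : η ^ 16 * m ≤ 7 * 10 ^ 8)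
    (hlow : 10 ^ 400 ≤ m) (hm : m ≤ 10 ^ 2100) : SieveCondition m η 31 := by
  have hm0 : m ≠ 0 := (lt_of_lt_of_le (by positivity) hlow).ne'
  have hm1 : (10 ^ 400 : ℝ) ≤ m := by exact_mod_cast hlow
  refine sieveCondition_of_bounds (y := 2000) (κ := 1145500) (η₀ := 3.6 / 10 ^ 25) (t := 831) (n := 1269)
    (a := 330) (b := 100) (A := 726906) (len := 292) hm0 (by norm_num) (by norm_num)
    {2, 3, 5, 7, 11, 13, 17, 19, 23, 29, 31} (by decide) (fun r hr h => ?_) hη hηm (by norm_num)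
    (by norm_num) (by norm_num) ?_ hm (by decide +kernel) (by norm_num) (by norm_num)
    (by decide +kernel) (by decide +kernel) (by norm_num)
  · interval_cases r <;> revert hr <;> decide
  · calc (7 * 10 ^ 8 : ℝ) ≤ (3.6 / 10 ^ 25) ^ 16 * (10 ^ 400) := by norm_num
      _ ≤ _ := by gcongr

lemma prod_sq_div_sub_one_le (z : ℕ) (hz : 1 ≤ z) :
    ∏ r ∈ (range (z + 1)).filter Nat.Prime, (r : ℝ) ^ 2 / ((r : ℝ) - 1) ≤ (4 : ℝ) ^ z * z := by
  have h1 : ∏ r ∈ (range (z + 1)).filter Nat.Prime, (r : ℝ) ≤ (4 : ℝ) ^ z := by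
    have := primorial_le_four_pow z
    rw [primorial] at this
    rw [← Nat.cast_prod]
    exact_mod_cast this
  have h2 : ∀ n : ℕ, 1 ≤ n → ∏ r ∈ Ioc 1 n, (r : ℝ) / ((r : ℝ) - 1) = n := by
    intro n hn
    induction n, hn using Nat.le_induction with
    | base => simp
    | succ n hn ih =>
      have hn0 : (n : ℝ) ≠ 0 := by exact_mod_cast (by omega : n ≠ 0)
      rw [prod_Ioc_succ_top hn, ih]
      push_cast
      rw [add_sub_cancel_right, mul_div_cancel₀ _ hn0]
  have hge : ∀ r ∈ Ioc 1 z, (1 : ℝ) ≤ (r : ℝ) / ((r : ℝ) - 1) := by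
    intro r hr
    have h3 : (2 : ℝ) ≤ r := by exact_mod_cast (mem_Ioc.1 hr).1
    rw [le_div_iff₀ (by linarith)]
    linarith
  have hsub : (range (z + 1)).filter Nat.Prime ⊆ Ioc 1 z := by
    intro r hr
    obtain ⟨h3, h4⟩ := mem_filter.1 hr
    exact mem_Ioc.2 ⟨h4.one_lt, Nat.lt_succ_iff.1 (mem_range.1 h3)⟩
  have h3 : ∏ r ∈ (range (z + 1)).filter Nat.Prime, (r : ℝ) / ((r : ℝ) - 1) ≤ z := by
    rw [← h2 z hz, ← prod_sdiff hsub]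
    refine le_mul_of_one_le_left
      (prod_nonneg fun r hr => zero_le_one.trans (hge r (hsub hr))) ?_
    exact one_le_prod fun r hr => hge r (mem_sdiff.1 hr).1
  have h4 : ∏ r ∈ (range (z + 1)).filter Nat.Prime, (r : ℝ) ^ 2 / ((r : ℝ) - 1) =
      (∏ r ∈ (range (z + 1)).filter Nat.Prime, (r : ℝ)) *
        ∏ r ∈ (range (z + 1)).filter Nat.Prime, (r : ℝ) / ((r : ℝ) - 1) := by
    rw [← prod_mul_distrib]
    exact prod_congr rfl fun r _ => by ring
  rw [h4]
  exact mul_le_mul h1 h3 (prod_nonneg fun r hr => zero_le_one.trans (hge r (hsub hr)))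
    (by positivity)

lemma sum_Ico_one_div_le {K : ℕ} (hK : 0 < K) {n : ℕ} (hn : K ≤ n) :
    ∑ j ∈ Ico K (n + 1), 1 / (j : ℝ) ≤ 1 / K + Real.log ((n : ℝ) / K) := by
  have hK0 : (0 : ℝ) < K := by exact_mod_cast hK
  induction n, hn using Nat.le_induction with
  | base => simp [hK0.ne']
  | succ n hn ih =>
    have hn0 : (0 : ℝ) < n := by exact_mod_cast hK.trans_le hn
    rw [sum_Ico_succ_top (by omega)]
    have h1 : (1 : ℝ) / (n + 1 : ℕ) ≤ Real.log ((n + 1 : ℕ) / (n : ℝ)) := by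
      have h2 := Real.one_sub_inv_le_log_of_pos (x := (n + 1 : ℕ) / (n : ℝ)) (by positivity)
      refine le_trans (le_of_eq ?_) h2
      push_cast
      field_simp
      ring
    have h2 : Real.log (((n + 1 : ℕ) : ℝ) / K) =
        Real.log ((n : ℝ) / K) + Real.log ((n + 1 : ℕ) / (n : ℝ)) := by
      rw [← Real.log_mul (by positivity) (by positivity)]
      congr 1
      field_simp
    rw [h2]
    linarith

lemma sum_one_div_coprime_thirty_le {K M : ℕ} (hK : 0 < K) :
    ∑ q ∈ (Ico (30 * K) (30 * M)).filter (Nat.Coprime 30), 1 / (q : ℝ) ≤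
      8 / 30 * ∑ j ∈ Ico K M, 1 / (j : ℝ) := by
  have hmaps : ∀ q ∈ (Ico (30 * K) (30 * M)).filter (Nat.Coprime 30), q / 30 ∈ Ico K M := by
    intro q hq
    have := mem_Ico.1 (mem_filter.1 hq).1
    exact mem_Ico.2 (by omega)
  rw [← sum_fiberwise_of_maps_to hmaps, mul_sum]
  refine sum_le_sum fun j hj => ?_
  have hj0 : (0 : ℝ) < j := by exact_mod_cast hK.trans_le (mem_Ico.1 hj).1
  set F := ((Ico (30 * K) (30 * M)).filter (Nat.Coprime 30)).filter (fun q => q / 30 = j) with hF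
  have h1 : F.card ≤ 8 := by
    have h2 : ((range 30).filter (Nat.Coprime 30)).card = 8 := by decide
    rw [← h2]
    refine card_le_card_of_injOn (· % 30) ?_ ?_
    · intro q hq
      have h3 := (mem_filter.1 (mem_filter.1 hq).1).2
      refine mem_coe.2 (mem_filter.2 ⟨mem_range.2 (Nat.mod_lt _ (by norm_num)), ?_⟩)
      exact (coprime_mod_iff dvd_rfl q).2 h3
    · intro q hq q' hq' h
      have h3 := (mem_filter.1 hq).2
      have h4 := (mem_filter.1 hq').2
      simp only at h
      omega
  calc ∑ q ∈ F, 1 / (q : ℝ) ≤ F.card • (1 / (30 * (j : ℝ))) := by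
        refine sum_le_card_nsmul _ _ _ fun q hq => ?_
        have h3 := (mem_filter.1 hq).2
        have h4 : 30 * j ≤ q := by omega
        exact one_div_le_one_div_of_le (by positivity) (by exact_mod_cast h4)
    _ ≤ 8 * (1 / (30 * (j : ℝ))) := by
        rw [nsmul_eq_mul]
        gcongr
        exact_mod_cast h1
    _ = _ := by field_simp

lemma two_pow_bound {K : ℕ} (hK : 10 ≤ K) :
    (30 * (K : ℝ)) ^ 8 * (7 * 10 ^ 8) * (10 ^ 6 * K) ^ 16 ≤ 2 ^ (200 * K) := by
  have h1 : (K : ℝ) ≤ 2 ^ K := by exact_mod_cast Nat.lt_two_pow_self.le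
  have h2 : (2 : ℝ) ^ 1760 ≤ 2 ^ (176 * K) := pow_le_pow_right₀ (by norm_num) (by omega)
  have h3 : (30 : ℝ) ^ 8 * (7 * 10 ^ 8) * (10 ^ 6) ^ 16 ≤ 2 ^ 1760 := by
    calc (30 : ℝ) ^ 8 * (7 * 10 ^ 8) * (10 ^ 6) ^ 16 ≤ ((2 : ℝ) ^ 100) ^ 5 := by norm_num
      _ = 2 ^ 500 := by rw [← pow_mul]
      _ ≤ _ := pow_le_pow_right₀ (by norm_num) (by norm_num)
  calc _ = (30 : ℝ) ^ 8 * (7 * 10 ^ 8) * (10 ^ 6) ^ 16 * (K : ℝ) ^ 24 := by ring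
    _ ≤ 2 ^ (176 * K) * (2 ^ K) ^ 24 := by
        gcongr
        exact h3.trans h2
    _ = _ := by rw [← pow_mul, ← pow_add]; congr 1; ring

lemma sieveCondition_of_large {m : ℕ} {η : ℝ} (hηm : η ^ 16 * m ≤ 7 * 10 ^ 8)
    (hlow : 10 ^ 2100 ≤ m) : ∃ z, 2 ≤ z ∧ SieveCondition m η z := by
  have hm0 : m ≠ 0 := (lt_of_lt_of_le (pow_pos (by norm_num) _) hlow).ne'
  have hm1 : (0 : ℝ) < m := by exact_mod_cast Nat.pos_of_ne_zero hm0
  have hL : 4800 ≤ Real.log m := by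
    have h1 : Real.log ((10 : ℝ) ^ 2100) ≤ Real.log m :=
      Real.log_le_log (pow_pos (by norm_num) _) (by
        have := Nat.cast_le (α := ℝ).2 hlow
        rwa [Nat.cast_pow] at this)
    rw [Real.log_pow] at h1
    have h2 : (3.3 : ℝ) * Real.log 2 ≤ Real.log 10 := by
      have h3 : Real.log ((2 : ℝ) ^ 33) ≤ Real.log ((10 : ℝ) ^ 10) :=
        Real.log_le_log (by norm_num) (by norm_num)
      rw [Real.log_pow, Real.log_pow] at h3
      push_cast at h3
      linarith
    have h4 := Real.log_two_gt_d9
    push_cast at h1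
    linarith
  set K := ⌊Real.log m / 480⌋₊ with hK
  have hK10 : 10 ≤ K := Nat.le_floor (by push_cast; linarith)
  have hKL : (480 * K : ℝ) ≤ Real.log m := by
    have := Nat.floor_le (a := Real.log m / 480) (by positivity)
    rw [← hK] at this
    linarith
  have hLK : Real.log m ≤ 528 * K := by
    have h1 := Nat.lt_floor_add_one (Real.log m / 480)
    rw [← hK] at h1
    have h2 : (10 : ℝ) ≤ K := by exact_mod_cast hK10
    linarith
  have hKr : (10 : ℝ) ≤ K := by exact_mod_cast hK10
  have hK0 : (0 : ℝ) < K := by linarith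
  refine ⟨30 * K, by omega, ?_⟩
  set κ := ∏ r ∈ m.primeFactors.filter (· ≤ 30 * K), (r : ℝ) / √((r : ℝ) - 1) with hκ
  set w : ℝ := 1 / (10 ^ 6 * K) with hw
  have hw0 : 0 < w := by positivity
  have hκ0 : 0 ≤ κ := prod_nonneg fun r _ => by positivity
  have hκw : κ * η ≤ w := by
    have h1 : κ ^ 2 ≤ (4 : ℝ) ^ (30 * K) * (30 * (K : ℝ)) := by
      have h2 := (sq_prod_primeFactors_le m (z := 30 * K)
        ((range (30 * K + 1)).filter Nat.Prime)
        (fun r hr => (mem_filter.1 hr).2.two_le)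
        (fun r hr h => mem_filter.2 ⟨mem_range.2 (Nat.lt_succ_iff.2 h), hr⟩)).trans
        (prod_sq_div_sub_one_le (30 * K) (by omega))
      push_cast at h2
      exact h2
    have h2 : κ ^ 16 ≤ (2 : ℝ) ^ (480 * K) * (30 * (K : ℝ)) ^ 8 := by
      calc κ ^ 16 = (κ ^ 2) ^ 8 := by ring
        _ ≤ ((4 : ℝ) ^ (30 * K) * (30 * (K : ℝ))) ^ 8 := pow_le_pow_left₀ (sq_nonneg _) h1 8
        _ = _ := by
          rw [mul_pow, ← pow_mul, show (4 : ℝ) = 2 ^ 2 by norm_num, ← pow_mul]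
          congr 2
          ring
    have h3 : (2 : ℝ) ^ (480 * K) * 2 ^ (200 * K) ≤ m := by
      have h4 : (2.7 : ℝ) ^ (480 * K) ≤ m := by
        have h5 : (m : ℝ) = Real.exp (Real.log m) := (Real.exp_log hm1).symm
        rw [h5]
        refine le_trans ?_ (Real.exp_le_exp.2 hKL)
        have h6 : Real.exp (480 * K) = Real.exp 1 ^ (480 * K) := by
          rw [← Real.exp_nat_mul]; push_cast; ring_nf
        rw [h6]
        have := Real.exp_one_gt_d9
        exact pow_le_pow_left₀ (by norm_num) (by linarith) _
      refine le_trans ?_ h4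
      rw [pow_mul, pow_mul, pow_mul, ← mul_pow]
      refine pow_le_pow_left₀ (by positivity) ?_ _
      have h5 : (2 : ℝ) ^ 5 ≤ 1.35 ^ 12 := by norm_num
      calc (2 : ℝ) ^ 480 * 2 ^ 200 = 2 ^ 480 * (2 ^ 5) ^ 40 := by rw [← pow_mul]
        _ ≤ 2 ^ 480 * (1.35 ^ 12) ^ 40 := by gcongr
        _ = (2 * 1.35) ^ 480 := by rw [← pow_mul, mul_pow]
        _ = _ := by norm_num
    have h4 : (κ * η) ^ 16 * m ≤ w ^ 16 * m := by
      calc (κ * η) ^ 16 * m = κ ^ 16 * (η ^ 16 * m) := by ring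
        _ ≤ (2 : ℝ) ^ (480 * K) * (30 * (K : ℝ)) ^ 8 * (7 * 10 ^ 8) := by gcongr
        _ = w ^ 16 * ((2 : ℝ) ^ (480 * K) *
            ((30 * (K : ℝ)) ^ 8 * (7 * 10 ^ 8) * (10 ^ 6 * (K : ℝ)) ^ 16)) := by
          rw [hw]; field_simp
        _ ≤ w ^ 16 * ((2 : ℝ) ^ (480 * K) * 2 ^ (200 * K)) := by
          gcongr
          exact two_pow_bound hK10
        _ ≤ _ := by gcongr
    exact le_of_pow_le_pow_left₀ (by norm_num) hw0.le (le_of_mul_le_mul_right h4 hm1)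
  refine sum_primeFactors_mono hκw ?_
  set T := (Ico (30 * K) (30 * (8 * K))).filter (Nat.Coprime 30) with hT
  have hTmem : ∀ q ∈ T, 2 ≤ q ∧ q < 240 * K := by
    intro q hq
    have := mem_Ico.1 (mem_filter.1 hq).1
    omega
  have h1 := sum_primeFactors_le (z := 30 * K) (y := 240 * K) hm0 (by omega) T hTmem
    (fun q hq h2 h3 => by
      refine mem_filter.2 ⟨mem_Ico.2 (by omega), ?_⟩
      rw [Nat.coprime_comm]
      refine (hq.coprime_iff_not_dvd).2 fun h => ?_
      have := Nat.le_of_dvd (by norm_num) h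
      omega) hw0.le
  have h2 : ∑ q ∈ T, 1 / (q : ℝ) ≤ 0.582 := by
    have h3 := sum_one_div_coprime_thirty_le (K := K) (M := 8 * K) (by omega)
    have h4 := sum_Ico_one_div_le (K := K) (n := 8 * K) (by omega) (by omega)
    rw [sum_Ico_succ_top (by omega)] at h4
    have h8 : (0 : ℝ) ≤ 1 / (8 * K : ℕ) := by positivity
    have h5 : Real.log (((8 * K : ℕ) : ℝ) / K) = 3 * Real.log 2 := by
      push_cast
      rw [mul_div_cancel_right₀ _ hK0.ne', show (8 : ℝ) = 2 ^ 3 by norm_num, Real.log_pow]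
      norm_num
    have h6 := Real.log_two_lt_d9
    have h7 : (1 : ℝ) / K ≤ 1 / 10 := one_div_le_one_div_of_le (by norm_num) hKr
    rw [h5] at h4
    linarith
  have hKw : K * w = 1 / 10 ^ 6 := by rw [hw]; field_simp
  have h3 : ∑ q ∈ T, (1 / (q : ℝ) + w) ≤ 0.583 := by
    rw [sum_add_distrib, sum_const, nsmul_eq_mul]
    have h4 : T.card ≤ 240 * K := by
      have h5 := card_filter_le (Ico (30 * K) (30 * (8 * K))) (Nat.Coprime 30)
      rw [Nat.card_Ico] at h5
      exact h5.trans (by omega)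
    have h5 : (T.card : ℝ) * w ≤ 240 * K * w := by
      gcongr
      exact_mod_cast h4
    have h6 : 240 * (K : ℝ) * w = 240 * (1 / 10 ^ 6) := by rw [mul_assoc, hKw]
    norm_num at h6 h2 ⊢
    linarith
  have hlogy : 7.6 ≤ Real.log ((240 * K : ℕ) : ℝ) := by
    have h4 : Real.log ((2 : ℝ) ^ 11) ≤ Real.log ((240 * K : ℕ) : ℝ) := by
      refine Real.log_le_log (by norm_num) ?_
      push_cast
      linarith
    rw [Real.log_pow] at h4
    have h5 := Real.log_two_gt_d9
    push_cast at h4 ⊢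
    linarith
  have h4 : (1 / ((240 * K : ℕ) : ℝ) + w) / Real.log ((240 * K : ℕ) : ℝ) *
      (Real.log m - ∑ q ∈ T, Real.log q) ≤ 0.3 := by
    have h5 : 0 ≤ ∑ q ∈ T, Real.log q := sum_nonneg fun q _ => Real.log_natCast_nonneg q
    calc _ ≤ (1 / ((240 * K : ℕ) : ℝ) + w) / Real.log ((240 * K : ℕ) : ℝ) * (528 * K) :=
          mul_le_mul_of_nonneg_left (by linarith) (by positivity)
      _ ≤ (1 / ((240 * K : ℕ) : ℝ) + w) / 7.6 * (528 * K) := by gcongr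
      _ = (2.2 + 528 * (K * w)) / 7.6 := by
          push_cast
          field_simp
          ring
      _ ≤ 0.3 := by rw [hKw]; norm_num
  have h5 : w ≤ 0.01 := by
    have h6 : w ≤ K * w := le_mul_of_one_le_left hw0.le (by linarith)
    rw [hKw] at h6
    norm_num at h6 ⊢
    linarith
  linarith

end Sieve

theorem grosswald_large_range (p : ℕ) (hp : p.Prime) (h : (p : ℝ) > 3.67 * 10 ^ 71) :
    (leastPrimitiveRoot p : ℝ) ≤ Real.sqrt p - 2 := by
  have hp1 : 3670 * 10 ^ 68 < p := by
    have : ((3670 * 10 ^ 68 : ℕ) : ℝ) < p := by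
      refine lt_of_le_of_lt (le_of_eq ?_) h
      norm_num
    exact_mod_cast this
  obtain ⟨Q, hQp, hpQ⟩ : ∃ Q : ℕ, 16 * Q ^ 4 ≤ p ∧ p < 16 * (Q + 1) ^ 4 := by
    have h0 : p < 16 * (p + 1) ^ 4 := by
      have := Nat.le_self_pow (n := 4) (by norm_num) (p + 1)
      omega
    have hex : ∃ n : ℕ, p < 16 * (n + 1) ^ 4 := ⟨p, h0⟩
    classical
    refine ⟨Nat.find hex, ?_, Nat.find_spec hex⟩
    rcases Nat.eq_zero_or_pos (Nat.find hex) with h1 | h1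
    · simp [h1]
    · have h2 := Nat.find_min hex (m := Nat.find hex - 1) (by omega)
      rw [Nat.sub_add_cancel h1] at h2
      omega
  have hQ : 1000 ≤ Q := by
    by_contra! hQ
    have : (Q + 1) ^ 4 ≤ 1000 ^ 4 := Nat.pow_le_pow_left hQ 4
    omega
  have hQr : (1000 : ℝ) ≤ Q := by exact_mod_cast hQ
  set η : ℝ := √√(80 / Q) with hη
  have hη0 : 0 ≤ η := Real.sqrt_nonneg _
  have hη4 : η ^ 4 = 80 / Q := by
    rw [show η ^ 4 = (η ^ 2) ^ 2 by ring, hη, Real.sq_sqrt (Real.sqrt_nonneg _),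
      Real.sq_sqrt (by positivity)]
  have hηm : η ^ 16 * ((p - 1 : ℕ) : ℝ) ≤ 7 * 10 ^ 8 := by
    have h1 : ((p - 1 : ℕ) : ℝ) ≤ 16 * (1.001 * Q) ^ 4 := by
      calc ((p - 1 : ℕ) : ℝ) ≤ ((16 * (Q + 1) ^ 4 : ℕ) : ℝ) := Nat.cast_le.2 (by omega)
        _ = 16 * ((Q : ℝ) + 1) ^ 4 := by push_cast; rfl
        _ ≤ _ := by gcongr; linarith
    calc η ^ 16 * ((p - 1 : ℕ) : ℝ) ≤ (η ^ 4) ^ 4 * (16 * (1.001 * Q) ^ 4) := by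
          rw [← pow_mul]; gcongr
      _ = 80 ^ 4 * 16 * 1.001 ^ 4 := by
          have : (Q : ℝ) ≠ 0 := by linarith
          rw [hη4]; field_simp
      _ ≤ _ := by norm_num
  obtain ⟨z, hz, hsieve⟩ : ∃ z, 2 ≤ z ∧ SieveCondition (p - 1) η z := by
    rcases le_total (p - 1) (10 ^ 82) with h1 | h1
    · exact ⟨5, by norm_num, sieveCondition_five hη0 hηm (by omega) h1⟩
    rcases le_total (p - 1) (10 ^ 120) with h2 | h2
    · exact ⟨7, by norm_num, sieveCondition_seven hη0 hηm h1 h2⟩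
    rcases le_total (p - 1) (10 ^ 400) with h3 | h3
    · exact ⟨11, by norm_num, sieveCondition_eleven hη0 hηm h2 h3⟩
    rcases le_total (p - 1) (10 ^ 2100) with h4 | h4
    · exact ⟨31, by norm_num, sieveCondition_thirtyOne hη0 hηm h3 h4⟩
    · exact sieveCondition_of_large hηm h4
  have hle := leastPrimitiveRoot_le_of_sieve hp hQ hQp hpQ hη0 hη4 hz hsieve
  have hsqrt : 4 * (Q : ℝ) ^ 2 ≤ √(p : ℝ) := by
    refine Real.le_sqrt_of_sq_le ?_
    calc (4 * (Q : ℝ) ^ 2) ^ 2 = ((16 * Q ^ 4 : ℕ) : ℝ) := by push_cast; ring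
      _ ≤ p := Nat.cast_le.2 hQp
  have hle' : leastPrimitiveRoot p + 2 ≤ 4 * Q ^ 2 := by
    have : 1 ≤ Q ^ 2 := Nat.one_le_pow _ _ (by omega)
    omega
  have : (leastPrimitiveRoot p : ℝ) + 2 ≤ 4 * (Q : ℝ) ^ 2 := by exact_mod_cast hle'
  linarith
end

section
/- For every prime p, g(p) ≤ 5.19·p^{0.99}. -/
open Finset

/-- The indicator of `x ^ m = w` on nonzero `x`, balanced by its expected value `1 / d`. -/
noncomputable def balancedPowIndicator {F : Type*} [Field F] [DecidableEq F]
    (m d : ℕ) (w x : F) : ℝ :=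
  if x = 0 then 0 else (if x ^ m = w then 1 else 0) - 1 / d

theorem Polynomial.card_nthRootsFinset_le {R : Type*} [CommRing R] [IsDomain R] (n : ℕ) (a : R) :
    #(Polynomial.nthRootsFinset n a) ≤ n := by
  classical
  rw [Polynomial.nthRootsFinset_def]
  exact (Multiset.toFinset_card_le _).trans (Polynomial.card_nthRoots n a)

theorem sum_balancedPowIndicator_mul_le {F : Type*} [Field F] [DecidableEq F]
    {m d : ℕ} (hd : 0 < d) {x y : F} (hx : x ≠ 0) (hy : y ≠ 0)
    (hxd : (x ^ m) ^ d = 1) (hyd : (y ^ m) ^ d = 1) :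
    ∑ w ∈ Polynomial.nthRootsFinset d (1 : F),
        balancedPowIndicator m d w x * balancedPowIndicator m d w y ≤
      (if x ^ m = y ^ m then 1 else 0) - 1 / (d : ℝ) := by
  have hW : (#(Polynomial.nthRootsFinset d (1 : F)) : ℝ) ≤ d := by
    exact_mod_cast Polynomial.card_nthRootsFinset_le d (1 : F)
  have hxW : x ^ m ∈ Polynomial.nthRootsFinset d (1 : F) :=
    (Polynomial.mem_nthRootsFinset hd 1).2 hxd
  have hyW : y ^ m ∈ Polynomial.nthRootsFinset d (1 : F) :=
    (Polynomial.mem_nthRootsFinset hd 1).2 hyd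
  have hd' : (0 : ℝ) < d := by exact_mod_cast hd
  simp only [balancedPowIndicator, if_neg hx, if_neg hy, sub_mul, mul_sub, sum_sub_distrib,
    ite_mul, mul_ite, one_mul, mul_one, zero_mul, mul_zero, sum_ite_eq, hxW, hyW, if_true,
    sum_const, nsmul_eq_mul]
  have h : (#(Polynomial.nthRootsFinset d (1 : F)) : ℝ) * (1 / d * (1 / d)) ≤ 1 / d := by
    calc _ ≤ (d : ℝ) * (1 / d * (1 / d)) := by gcongr
      _ = 1 / d := by field_simp
  linarith

theorem card_filter_add_pow_eq_lt {F : Type*} [Field F] [Fintype F] [DecidableEq F]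
    {m : ℕ} (hm : 0 < m) {b c : F} (hbc : b ≠ c) :
    #{a : F | (a + b ≠ 0 ∧ a + c ≠ 0) ∧ (a + b) ^ m = (a + c) ^ m} < m := by
  have hone : (1 : F) ∈ Polynomial.nthRootsFinset m (1 : F) :=
    (Polynomial.mem_nthRootsFinset hm 1).2 (one_pow m)
  have hcard : #(Polynomial.nthRootsFinset m (1 : F)) ≤ m :=
    Polynomial.card_nthRootsFinset_le m 1
  refine lt_of_le_of_lt (card_le_card_of_injOn (fun a => (a + b) / (a + c))
    (t := (Polynomial.nthRootsFinset m (1 : F)).erase 1) ?_ ?_)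
    ((card_erase_lt_of_mem hone).trans_le hcard)
  · intro a ha
    simp only [coe_filter, mem_univ, true_and, Set.mem_ofPred_eq] at ha
    obtain ⟨⟨hb, hc⟩, h⟩ := ha
    simp only [mem_coe, mem_erase, Polynomial.mem_nthRootsFinset hm, div_pow, h]
    refine ⟨fun h1 => hbc ?_, div_self (pow_ne_zero _ hc)⟩
    rw [div_eq_one_iff_eq hc] at h1
    exact add_left_cancel h1
  · intro a ha a' ha' h
    simp only [coe_filter, mem_univ, true_and, Set.mem_ofPred_eq] at ha ha'
    simp only [div_eq_div_iff ha.1.2 ha'.1.2] at h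
    have : (a - a') * (c - b) = 0 := by linear_combination h
    rcases mul_eq_zero.1 this with h | h
    · exact sub_eq_zero.1 h
    · exact absurd (sub_eq_zero.1 h).symm hbc

/-- Distinct shifts of the balanced indicators are nonpositively correlated. -/
theorem sum_sum_balancedPowIndicator_mul_le {F : Type*} [Field F] [Fintype F] [DecidableEq F]
    {m d : ℕ} (hmd : Fintype.card F = m * d + 1) (hm : 0 < m) (hd : 0 < d) (b c : F) :
    ∑ a : F, ∑ w ∈ Polynomial.nthRootsFinset d (1 : F),
        balancedPowIndicator m d w (a + b) * balancedPowIndicator m d w (a + c) ≤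
      if b = c then (Fintype.card F : ℝ) else 0 := by
  have hpow (x : F) (hx : x ≠ 0) : (x ^ m) ^ d = 1 := by
    rw [← pow_mul, ← FiniteField.pow_card_sub_one_eq_one x hx, hmd, Nat.add_sub_cancel]
  have hle (a : F) : ∑ w ∈ Polynomial.nthRootsFinset d (1 : F),
        balancedPowIndicator m d w (a + b) * balancedPowIndicator m d w (a + c) ≤
      if a + b ≠ 0 ∧ a + c ≠ 0 then
        (if (a + b) ^ m = (a + c) ^ m then 1 else 0) - 1 / (d : ℝ) else 0 := by
    split_ifs with h h'
    · simpa [h'] using sum_balancedPowIndicator_mul_le hd h.1 h.2 (hpow _ h.1) (hpow _ h.2)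
    · simpa [h'] using sum_balancedPowIndicator_mul_le hd h.1 h.2 (hpow _ h.1) (hpow _ h.2)
    · refine (sum_eq_zero fun w _ => ?_).le
      rw [not_and_or, not_not, not_not] at h
      rcases h with h | h <;> simp [balancedPowIndicator, h]
  have hd' : (0 : ℝ) < d := by exact_mod_cast hd
  refine (sum_le_sum fun a _ => hle a).trans ?_
  split_ifs with hbc
  · subst hbc
    calc _ ≤ ∑ _a : F, (1 : ℝ) := by
          refine sum_le_sum fun a _ => ?_
          have : 0 ≤ 1 / (d : ℝ) := by positivity
          split_ifs <;> linarith
      _ = _ := by simp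
  · rw [← sum_filter, sum_sub_distrib, sum_const, nsmul_eq_mul, ← sum_filter, filter_filter,
      sum_const, nsmul_eq_mul, mul_one]
    have h1 : (#{a : F | (a + b ≠ 0 ∧ a + c ≠ 0) ∧ (a + b) ^ m = (a + c) ^ m} : ℝ) + 1 ≤ m := by
      exact_mod_cast card_filter_add_pow_eq_lt hm hbc
    have h2 : (#{a : F | a + b ≠ 0 ∧ a + c ≠ 0} : ℝ) = m * d - 1 := by
      have : ({a : F | a + b ≠ 0 ∧ a + c ≠ 0} : Finset F) = univ \ {-b, -c} := by
        ext a
        simp [add_eq_zero_iff_eq_neg]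
      rw [this, cast_card_sdiff (subset_univ _), card_univ, card_pair (by simpa using hbc), hmd]
      push_cast
      ring
    rw [h2]
    have h3 : ((m : ℝ) * d - 1) * (1 / d) = m - 1 / d := by field_simp
    have h4 : 1 / (d : ℝ) ≤ 1 := by
      rw [div_le_one hd']
      exact_mod_cast hd
    linarith

theorem sum_sq_sum_balancedPowIndicator_le {F : Type*} [Field F] [Fintype F] [DecidableEq F]
    {m d : ℕ} (hmd : Fintype.card F = m * d + 1) (hm : 0 < m) (hd : 0 < d) (B : Finset F) :
    ∑ a : F, (∑ b ∈ B, balancedPowIndicator m d 1 (a + b)) ^ 2 ≤ Fintype.card F * #B := by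
  have hone : (1 : F) ∈ Polynomial.nthRootsFinset d (1 : F) :=
    (Polynomial.mem_nthRootsFinset hd 1).2 (one_pow d)
  calc _ ≤ ∑ a : F, ∑ w ∈ Polynomial.nthRootsFinset d (1 : F),
        (∑ b ∈ B, balancedPowIndicator m d w (a + b)) ^ 2 :=
        sum_le_sum fun a _ => single_le_sum
          (f := fun w => (∑ b ∈ B, balancedPowIndicator m d w (a + b)) ^ 2)
          (fun w _ => sq_nonneg _) hone
    _ = ∑ b ∈ B, ∑ c ∈ B, ∑ a : F, ∑ w ∈ Polynomial.nthRootsFinset d (1 : F),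
        balancedPowIndicator m d w (a + b) * balancedPowIndicator m d w (a + c) := by
        simp only [sq, sum_mul_sum]
        rw [sum_congr rfl fun a _ => sum_comm, sum_comm]
        refine sum_congr rfl fun b _ => ?_
        rw [sum_congr rfl fun a _ => sum_comm, sum_comm]
    _ ≤ ∑ b ∈ B, ∑ c ∈ B, if b = c then (Fintype.card F : ℝ) else 0 :=
        sum_le_sum fun b _ => sum_le_sum fun c _ =>
          sum_sum_balancedPowIndicator_mul_le hmd hm hd b c
    _ = Fintype.card F * #B := by
        simp [sum_ite_eq, mul_comm]

/-- Over all sums `a + b`, the `m`-th roots of unity are equidistributed with square-root error. -/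
theorem abs_sum_sum_balancedPowIndicator_le {F : Type*} [Field F] [Fintype F] [DecidableEq F]
    {m d : ℕ} (hmd : Fintype.card F = m * d + 1) (hm : 0 < m) (hd : 0 < d) (A B : Finset F) :
    |∑ a ∈ A, ∑ b ∈ B, balancedPowIndicator m d 1 (a + b)| ≤
      √(Fintype.card F * #A * #B) := by
  refine Real.abs_le_sqrt ?_
  calc _ ≤ #A * ∑ a ∈ A, (∑ b ∈ B, balancedPowIndicator m d 1 (a + b)) ^ 2 :=
        sq_sum_le_card_mul_sum_sq
    _ ≤ #A * ∑ a : F, (∑ b ∈ B, balancedPowIndicator m d 1 (a + b)) ^ 2 := by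
        gcongr
        exact subset_univ A
    _ ≤ #A * (Fintype.card F * #B) := by
        gcongr
        exact sum_sq_sum_balancedPowIndicator_le hmd hm hd B
    _ = _ := by ring


open ArithmeticFunction ArithmeticFunction.Moebius in
theorem sum_divisors_moebius (n : ℕ) :
    ∑ e ∈ n.divisors, (μ e : ℤ) = if n = 1 then 1 else 0 := by
  rw [← coe_mul_zeta_apply, moebius_mul_coe_zeta, one_apply]

open ArithmeticFunction ArithmeticFunction.Moebius in
/-- Möbius sieve: the divisor sum vanishes at elements whose order is a proper divisor of `n`. -/
theorem sum_divisors_moebius_mul_pow_eq_one {G : Type*} [Monoid G] [DecidableEq G] {n : ℕ}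
    (hn : 0 < n) {x : G} (hx : x ^ n = 1) (hord : orderOf x ≠ n) :
    ∑ e ∈ n.divisors, (μ e : ℝ) * (if x ^ (n / e) = 1 then 1 else 0) = 0 := by
  have hdvd := orderOf_dvd_of_pow_eq_one hx
  have hfilter : {e ∈ n.divisors | x ^ (n / e) = 1} = (n / orderOf x).divisors := by
    ext e
    simp only [mem_filter, Nat.mem_divisors, ← orderOf_dvd_iff_pow_eq_one]
    have hq : n / orderOf x ≠ 0 := (Nat.div_pos (Nat.le_of_dvd hn hdvd)
      (Nat.pos_of_dvd_of_pos hdvd hn)).ne'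
    constructor
    · rintro ⟨⟨he, -⟩, h⟩
      exact ⟨(Nat.dvd_div_iff_mul_dvd hdvd).2 (mul_comm e _ ▸ (Nat.dvd_div_iff_mul_dvd he).1 h), hq⟩
    · rintro ⟨h, -⟩
      have he : e ∣ n := h.trans (Nat.div_dvd_of_dvd hdvd)
      exact ⟨⟨he, hn.ne'⟩, (Nat.dvd_div_iff_mul_dvd he).2
        (mul_comm e _ ▸ (Nat.dvd_div_iff_mul_dvd hdvd).1 h)⟩
  simp only [mul_ite, mul_one, mul_zero]
  rw [← sum_filter, hfilter]
  have hne : n / orderOf x ≠ 1 := fun h => hord (by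
    have := Nat.div_mul_cancel hdvd
    rwa [h, one_mul] at this)
  have := sum_divisors_moebius (n / orderOf x)
  rw [if_neg hne] at this
  exact_mod_cast this

open ArithmeticFunction ArithmeticFunction.Moebius in
theorem sum_divisors_moebius_div {n : ℕ} (hn : 0 < n) :
    ∑ e ∈ n.divisors, (μ e : ℝ) * (1 / e) = n.totient / n := by
  have h := (sum_eq_iff_sum_mul_moebius_eq (R := ℝ) (f := fun k => (k.totient : ℝ))
    (g := fun k => (k : ℝ))).1 (fun k _ => by exact_mod_cast Nat.sum_totient k) n hn
  have hn' : (n : ℝ) ≠ 0 := by exact_mod_cast hn.ne'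
  rw [← h, Nat.sum_divisorsAntidiagonal (fun i j => (μ i : ℝ) * (j : ℝ)), sum_div]
  refine sum_congr rfl fun e he => ?_
  have he' : (e : ℝ) ≠ 0 := by exact_mod_cast (Nat.pos_of_mem_divisors he).ne'
  rw [Nat.cast_div (Nat.dvd_of_mem_divisors he) he']
  field_simp

open ArithmeticFunction ArithmeticFunction.Moebius in
theorem sum_divisors_abs_moebius {n : ℕ} (hn : n ≠ 0) :
    ∑ e ∈ n.divisors, |(μ e : ℝ)| = 2 ^ #n.primeFactors := by
  have h (e : ℕ) : |(μ e : ℝ)| = if Squarefree e then 1 else 0 := by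
    exact_mod_cast congrArg (Int.cast (R := ℝ)) (abs_moebius (n := e))
  simp only [h]
  rw [← sum_filter, Nat.sum_divisors_filter_squarefree hn, sum_const, card_powerset, Nat.factors_eq]
  simp

theorem one_le_two_pow_mul_totient_div {n : ℕ} (hn : 0 < n) :
    1 ≤ (2 : ℝ) ^ #n.primeFactors * (n.totient / n) := by
  have hn' : (n : ℚ) ≠ 0 := by exact_mod_cast hn.ne'
  have h : (1 : ℚ) ≤ 2 ^ #n.primeFactors * (n.totient / n) := by
    rw [Nat.totient_eq_mul_prod_factors, mul_div_cancel_left₀ _ hn', ← prod_const,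
      ← prod_mul_distrib]
    refine one_le_prod fun q hq => ?_
    have hq2 : (2 : ℚ) ≤ q := by exact_mod_cast (Nat.prime_of_mem_primeFactors hq).two_le
    have : (q : ℚ)⁻¹ ≤ 2⁻¹ := inv_anti₀ two_pos hq2
    linarith
  have h' := (Rat.cast_le (K := ℝ)).2 h
  push_cast at h'
  exact h'

theorem four_pow_card_primeFactors_le {n : ℕ} (hn : n ≠ 0) :
    (4 : ℝ) ^ #n.primeFactors ≤ 4 ^ 11 * (n : ℝ) ^ (2 / 5 : ℝ) := by
  set T := {q ∈ n.primeFactors | 32 ≤ q} with hT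
  have hsmall : #{q ∈ n.primeFactors | ¬ 32 ≤ q} ≤ 11 := by
    calc _ ≤ #{q ∈ range 32 | q.Prime} := by
          refine card_le_card fun q hq => ?_
          rw [mem_filter] at hq ⊢
          exact ⟨mem_range.2 (by omega), Nat.prime_of_mem_primeFactors hq.1⟩
      _ = 11 := by decide
  have hcard : #n.primeFactors ≤ 11 + #T := by
    rw [← card_filter_add_card_filter_not (s := n.primeFactors) (fun q => 32 ≤ q), ← hT]
    omega
  have hprod : 32 ^ #T ≤ n := by
    calc 32 ^ #T ≤ ∏ q ∈ T, q := T.pow_card_le_prod _ _ (fun q hq => (mem_filter.1 hq).2)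
      _ ≤ ∏ q ∈ n.primeFactors, q := prod_le_prod_of_subset_of_one_le' (filter_subset _ _)
          fun q hq _ => (Nat.prime_of_mem_primeFactors hq).one_le
      _ ≤ n := Nat.le_of_dvd (Nat.pos_of_ne_zero hn) (Nat.prod_primeFactors_dvd n)
  have h4 : ((32 : ℝ) ^ #T) ^ (2 / 5 : ℝ) = 4 ^ #T := by
    rw [← Real.rpow_natCast, ← Real.rpow_mul (by norm_num), mul_comm, Real.rpow_mul (by norm_num),
      Real.rpow_natCast]
    congr 1
    rw [show (32 : ℝ) = 2 ^ (5 : ℝ) by norm_num, ← Real.rpow_mul (by norm_num)]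
    norm_num
  calc (4 : ℝ) ^ #n.primeFactors ≤ 4 ^ (11 + #T) := pow_le_pow_right₀ (by norm_num) hcard
    _ = 4 ^ 11 * ((32 : ℝ) ^ #T) ^ (2 / 5 : ℝ) := by rw [h4, pow_add]
    _ ≤ 4 ^ 11 * (n : ℝ) ^ (2 / 5 : ℝ) := by
        gcongr
        exact_mod_cast hprod

open ArithmeticFunction ArithmeticFunction.Moebius in
/-- A set whose sumset avoids zero and all primitive roots is small. -/
theorem card_le_of_forall_orderOf_add_ne {F : Type*} [Field F] [Fintype F] [DecidableEq F]
    {A : Finset F} (hA0 : ∀ a ∈ A, ∀ b ∈ A, a + b ≠ 0)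
    (hA : ∀ a ∈ A, ∀ b ∈ A, orderOf (a + b) ≠ Fintype.card F - 1) :
    (#A : ℝ) ≤ √(Fintype.card F) * 4 ^ #(Fintype.card F - 1).primeFactors := by
  set N := Fintype.card F - 1 with hN
  have hcard : Fintype.card F = N + 1 := by
    have := Fintype.one_lt_card (α := F)
    omega
  have hN0 : 0 < N := by
    have := Fintype.one_lt_card (α := F)
    omega
  rcases A.eq_empty_or_nonempty with rfl | hne
  · simp only [card_empty, Nat.cast_zero]
    positivity
  have hApos : (0 : ℝ) < #A := by exact_mod_cast hne.card_pos
  have hzero : ∑ e ∈ N.divisors, (μ e : ℝ) *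
      ∑ a ∈ A, ∑ b ∈ A, (if (a + b) ^ (N / e) = 1 then (1 : ℝ) else 0) = 0 := by
    simp only [mul_sum]
    rw [sum_comm]
    refine sum_eq_zero fun a ha => ?_
    rw [sum_comm]
    exact sum_eq_zero fun b hb => sum_divisors_moebius_mul_pow_eq_one hN0
      (FiniteField.pow_card_sub_one_eq_one _ (hA0 a ha b hb)) (hA a ha b hb)
  have hsplit (e : ℕ) : ∑ a ∈ A, ∑ b ∈ A, (if (a + b) ^ (N / e) = 1 then (1 : ℝ) else 0) =
      ∑ a ∈ A, ∑ b ∈ A, balancedPowIndicator (N / e) e 1 (a + b) + 1 / e * (#A * #A) := by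
    have (a : F) (ha : a ∈ A) (b : F) (hb : b ∈ A) :
        (if (a + b) ^ (N / e) = 1 then (1 : ℝ) else 0) =
          balancedPowIndicator (N / e) e 1 (a + b) + 1 / e := by
      rw [balancedPowIndicator, if_neg (hA0 a ha b hb), sub_add_cancel]
    rw [sum_congr rfl fun a ha => sum_congr rfl (this a ha)]
    simp only [sum_add_distrib, sum_const, nsmul_eq_mul]
    ring
  simp only [hsplit, mul_add, sum_add_distrib] at hzero
  simp only [← mul_assoc] at hzero
  simp only [← sum_mul] at hzero
  rw [sum_divisors_moebius_div hN0] at hzero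
  have herr : |∑ e ∈ N.divisors, (μ e : ℝ) *
      ∑ a ∈ A, ∑ b ∈ A, balancedPowIndicator (N / e) e 1 (a + b)| ≤
      2 ^ #N.primeFactors * (√(Fintype.card F) * #A) := by
    rw [← sum_divisors_abs_moebius hN0.ne', sum_mul]
    refine (abs_sum_le_sum_abs _ _).trans (sum_le_sum fun e he => ?_)
    rw [abs_mul]
    gcongr
    have hdvd := Nat.dvd_of_mem_divisors he
    have he0 := Nat.pos_of_mem_divisors he
    refine (abs_sum_sum_balancedPowIndicator_le ?_
      (Nat.div_pos (Nat.le_of_dvd hN0 hdvd) he0) he0 A A).trans_eq ?_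
    · rw [Nat.div_mul_cancel hdvd, hcard]
    · rw [mul_assoc, Real.sqrt_mul (by positivity), Real.sqrt_mul_self hApos.le]
  have hmain : (N.totient / N : ℝ) * #A ≤ 2 ^ #N.primeFactors * √(Fintype.card F) := by
    refine le_of_mul_le_mul_right ?_ hApos
    linarith [neg_le_abs (∑ e ∈ N.divisors, (μ e : ℝ) *
      ∑ a ∈ A, ∑ b ∈ A, balancedPowIndicator (N / e) e 1 (a + b))]
  calc (#A : ℝ) ≤ 2 ^ #N.primeFactors * (N.totient / N) * #A :=
        le_mul_of_one_le_left hApos.le (one_le_two_pow_mul_totient_div hN0)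
    _ = 2 ^ #N.primeFactors * (N.totient / N * #A) := mul_assoc _ _ _
    _ ≤ 2 ^ #N.primeFactors * (2 ^ #N.primeFactors * √(Fintype.card F)) := by gcongr
    _ = √(Fintype.card F) * 4 ^ #N.primeFactors := by
        rw [← mul_assoc, ← mul_pow, mul_comm]
        norm_num

theorem le_of_forall_orderOf_natCast_ne {p : ℕ} (hp : p.Prime) {H : ℕ} (hH : 2 * H < p)
    (h : ∀ n : ℕ, 0 < n → n ≤ 2 * H → orderOf (n : ZMod p) ≠ p - 1) :
    (H : ℝ) ≤ √p * 4 ^ #(p - 1).primeFactors := by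
  have := Fact.mk hp
  have hinj : Set.InjOn (Nat.cast : ℕ → ZMod p) (Icc 1 H) := by
    intro a ha b hb hab
    rw [mem_coe, mem_Icc] at ha hb
    have := congrArg ZMod.val hab
    rwa [ZMod.val_natCast_of_lt (by omega), ZMod.val_natCast_of_lt (by omega)] at this
  have key := card_le_of_forall_orderOf_add_ne (A := (Icc 1 H).image (Nat.cast : ℕ → ZMod p))
    (forall_mem_image.2 fun a ha => forall_mem_image.2 fun b hb => by
      rw [mem_Icc] at ha hb
      rw [← Nat.cast_add, Ne, ZMod.natCast_eq_zero_iff]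
      exact fun hdvd => absurd (Nat.le_of_dvd (by omega) hdvd) (by omega))
    (forall_mem_image.2 fun a ha => forall_mem_image.2 fun b hb => by
      rw [mem_Icc] at ha hb
      rw [← Nat.cast_add, ZMod.card]
      exact h _ (by omega) (by omega))
  rwa [card_image_of_injOn hinj, ZMod.card, Nat.card_Icc, Nat.add_sub_cancel] at key

theorem leastPrimitiveRoot_le_self {p : ℕ} (hp : p.Prime) : leastPrimitiveRoot p ≤ p := by
  have := Fact.mk hp
  obtain ⟨u, hu⟩ := IsCyclic.exists_ofOrder_eq_natCard (α := (ZMod p)ˣ)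
  have hmem : (u : ZMod p).val ∈ {n : ℕ | 0 < n ∧ orderOf ((n : ZMod p)) = p - 1} := by
    refine ⟨ZMod.val_pos.2 u.ne_zero, ?_⟩
    rw [ZMod.natCast_zmod_val, orderOf_units, hu, Nat.card_eq_fintype_card, ZMod.card_units]
  exact (Nat.sInf_le hmem).trans (ZMod.val_lt _).le

theorem leastPrimitiveRoot_le_mul_rpow {p : ℕ} (hp : p.Prime) :
    (leastPrimitiveRoot p : ℝ) ≤ (2 * 4 ^ 11 + 2) * (p : ℝ) ^ (9 / 10 : ℝ) := by
  have hp1 : (1 : ℝ) ≤ p := by exact_mod_cast hp.one_le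
  have hg := leastPrimitiveRoot_le_self hp
  have hp2 := hp.two_le
  set H := (leastPrimitiveRoot p - 1) / 2 with hH
  have hle : (H : ℝ) ≤ √p * 4 ^ #(p - 1).primeFactors :=
    le_of_forall_orderOf_natCast_ne hp (by omega) fun n hn0 hn hord =>
      Nat.notMem_of_lt_sInf (show n < leastPrimitiveRoot p by omega) ⟨hn0, hord⟩
  have hgH : (leastPrimitiveRoot p : ℝ) ≤ 2 * H + 2 := by
    exact_mod_cast (show leastPrimitiveRoot p ≤ 2 * H + 2 by omega)
  have hone : 1 ≤ (p : ℝ) ^ (9 / 10 : ℝ) := Real.one_le_rpow hp1 (by norm_num)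
  have hHle : (H : ℝ) ≤ 4 ^ 11 * (p : ℝ) ^ (9 / 10 : ℝ) := by
    calc (H : ℝ) ≤ √p * 4 ^ #(p - 1).primeFactors := hle
      _ ≤ √p * (4 ^ 11 * ((p - 1 : ℕ) : ℝ) ^ (2 / 5 : ℝ)) := by
          gcongr
          exact four_pow_card_primeFactors_le (by omega)
      _ ≤ √p * (4 ^ 11 * (p : ℝ) ^ (2 / 5 : ℝ)) := by
          gcongr
          omega
      _ = 4 ^ 11 * (p : ℝ) ^ (9 / 10 : ℝ) := by
          rw [Real.sqrt_eq_rpow, mul_left_comm, ← Real.rpow_add (by linarith)]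
          norm_num
  linarith

theorem leastPrimitiveRoot_le_all_p (p : ℕ) (hp : p.Prime) :
    (leastPrimitiveRoot p : ℝ) ≤ 5.19 * (p : ℝ) ^ (0.99 : ℝ) := by
  have hp0 : (0 : ℝ) < p := by exact_mod_cast hp.pos
  rcases le_total (p : ℝ) (5.19 ^ 100) with h | h
  · calc (leastPrimitiveRoot p : ℝ) ≤ p := by exact_mod_cast leastPrimitiveRoot_le_self hp
      _ = (p : ℝ) ^ (1 / 100 : ℝ) * (p : ℝ) ^ (0.99 : ℝ) := by
          rw [← Real.rpow_add hp0]
          norm_num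
      _ ≤ (5.19 ^ 100 : ℝ) ^ (1 / 100 : ℝ) * (p : ℝ) ^ (0.99 : ℝ) := by gcongr
      _ = 5.19 * (p : ℝ) ^ (0.99 : ℝ) := by
          rw [← Real.rpow_natCast, ← Real.rpow_mul (by norm_num)]
          norm_num
  · have h9 : (5.19 : ℝ) ^ 9 ≤ (p : ℝ) ^ (9 / 100 : ℝ) := by
      calc (5.19 : ℝ) ^ 9 = (5.19 ^ 100 : ℝ) ^ (9 / 100 : ℝ) := by
            rw [← Real.rpow_natCast, ← Real.rpow_natCast, ← Real.rpow_mul (by norm_num)]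
            norm_num
        _ ≤ (p : ℝ) ^ (9 / 100 : ℝ) := by gcongr
    calc (leastPrimitiveRoot p : ℝ) ≤ (2 * 4 ^ 11 + 2) * (p : ℝ) ^ (9 / 10 : ℝ) :=
          leastPrimitiveRoot_le_mul_rpow hp
      _ ≤ 5.19 * 5.19 ^ 9 * (p : ℝ) ^ (9 / 10 : ℝ) := by
          gcongr
          norm_num
      _ ≤ 5.19 * (p : ℝ) ^ (9 / 100 : ℝ) * (p : ℝ) ^ (9 / 10 : ℝ) := by gcongr
      _ = 5.19 * (p : ℝ) ^ (0.99 : ℝ) := by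
          rw [mul_assoc, ← Real.rpow_add hp0]
          norm_num
end
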